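/- Let p ∈ ℝ[x₁,…,xₙ] be a real-zero polynomial of degree d. Then there exist a nonzero homogeneous polynomial q ∈ ℝ[x₁,…,xₙ], an integer k > 0, and a k×d matrix 𝓠 with entries in ℝ[x₁,…,xₙ] such that q² · 𝓗(p) = 𝓠ᵀ𝓠. -/

import Mathlib

open Matrix

/-- Write `p = Σ_{i=0}^d p_i` with `p_i` homogeneous of degree `i`, and let
`P(x,t) = Σ_{i=0}^d p_i t^{d-i}` be the homogenization of `p` with respect to `t`.
This is the companion matrix `L_t` of `P` (as a monic polynomial in `t` of degree `d`):
subdiagonal entries `1`, last column `(-p_d, -p_{d-1}, …, -p_1)ᵀ`. -/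
noncomputable def companionM {n : ℕ} (d : ℕ) (p : MvPolynomial (Fin n) ℝ) :
    Matrix (Fin d) (Fin d) (MvPolynomial (Fin n) ℝ) := fun i j =>
  if (j : ℕ) = d - 1 then -(MvPolynomial.homogeneousComponent (d - (i : ℕ)) p)
  else if (i : ℕ) = (j : ℕ) + 1 then 1 else 0

/-- The parametrized Hermite matrix `𝓗(p)` of `p` (for `p` of degree `d`): the `d × d`
matrix over `ℝ[x₁,…,xₙ]` whose `(i,j)`-entry (1-based) is the Newton sum
`N_{i+j-2}(P) = trace (L_t^{i+j-2})`. -/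
noncomputable def hermiteM {n : ℕ} (d : ℕ) (p : MvPolynomial (Fin n) ℝ) :
    Matrix (Fin d) (Fin d) (MvPolynomial (Fin n) ℝ) := fun i j =>
  Matrix.trace (companionM d p ^ ((i : ℕ) + (j : ℕ)))

/-- A polynomial `p ∈ ℝ[x₁,…,xₙ]` with `p(0) = 1` is a real-zero polynomial if for every
`a ∈ ℝⁿ` all complex roots of the univariate polynomial `t ↦ p(ta)` are real. -/
def IsRealZero {n : ℕ} (p : MvPolynomial (Fin n) ℝ) : Prop :=
  MvPolynomial.constantCoeff p = 1 ∧
  ∀ (a : Fin n → ℝ) (z : ℂ),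
    (MvPolynomial.aeval (fun i => z * algebraMap ℝ ℂ (a i))) p = 0 → z.im = 0

/-- The symmetric linear matrix polynomial `𝓜 = x₁M₁ + ⋯ + xₙMₙ` determined by
matrices `M₁, …, Mₙ`. -/
noncomputable def pencil {n k : ℕ} (M : Fin n → Matrix (Fin k) (Fin k) ℝ) :
    Matrix (Fin k) (Fin k) (MvPolynomial (Fin n) ℝ) := fun i j =>
  ∑ l, MvPolynomial.X l * MvPolynomial.C (M l i j)

section

open Polynomial

universe u

/-- The intermediate value property for polynomials over an ordered field. -/
def PolynomialIVT (R : Type*) [Field R] [LinearOrder R] : Prop :=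
  ∀ (f : R[X]) (a b : R), a < b → f.eval a * f.eval b < 0 →
    ∃ c, a < c ∧ c < b ∧ f.eval c = 0

namespace PolynomialIVT

variable {R : Type*} [Field R] [LinearOrder R] [IsStrictOrderedRing R]

theorem sign_eval_eq (hR : PolynomialIVT R) {f : R[X]} {a b : R}
    (h : ∀ c ∈ Set.uIcc a b, f.eval c ≠ 0) :
    SignType.sign (f.eval a) = SignType.sign (f.eval b) := by
  wlog hab : a ≤ b generalizing a b
  · exact (this (by rwa [Set.uIcc_comm]) (le_of_not_ge hab)).symm
  rw [Set.uIcc_of_le hab] at h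
  have ha := h a ⟨le_rfl, hab⟩
  have hb := h b ⟨hab, le_rfl⟩
  rcases hab.eq_or_lt with rfl | hlt
  · rfl
  have key : ¬ f.eval a * f.eval b < 0 := fun hneg => by
    obtain ⟨c, hac, hcb, hc⟩ := hR f a b hlt hneg
    exact h c ⟨hac.le, hcb.le⟩ hc
  rcases lt_or_gt_of_ne ha with ha' | ha' <;> rcases lt_or_gt_of_ne hb with hb' | hb'
  · rw [sign_neg ha', sign_neg hb']
  · exact absurd (mul_neg_of_neg_of_pos ha' hb') key
  · exact absurd (mul_neg_of_pos_of_neg ha' hb') key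
  · rw [sign_pos ha', sign_pos hb']

theorem rolle_of_consecutive (hR : PolynomialIVT R) {f : R[X]} (hf : f ≠ 0) {a b : R}
    (hab : a < b) (ha : f.eval a = 0) (hb : f.eval b = 0)
    (hno : ∀ c, a < c → c < b → f.eval c ≠ 0) :
    ∃ c, a < c ∧ c < b ∧ f.derivative.eval c = 0 := by
  obtain ⟨g, hg, hga⟩ := exists_eq_pow_rootMultiplicity_mul_and_not_dvd f hf a
  have hg0 : g ≠ 0 := by rintro rfl; simp at hga
  obtain ⟨q, hq, hqb⟩ := exists_eq_pow_rootMultiplicity_mul_and_not_dvd g hg0 b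
  have hk : 0 < rootMultiplicity a f := (rootMultiplicity_pos hf).2 ha
  have hgb : g.eval b = 0 := by
    rw [hg] at hb
    simpa [sub_ne_zero.2 hab.ne'] using hb
  have hl : 0 < rootMultiplicity b g := (rootMultiplicity_pos hg0).2 hgb
  obtain ⟨k, hk⟩ := Nat.exists_eq_add_of_lt hk
  obtain ⟨l, hl⟩ := Nat.exists_eq_add_of_lt hl
  rw [hk] at hg
  rw [hl] at hq
  simp only [zero_add] at hg hq
  rw [dvd_iff_isRoot, IsRoot.def] at hga hqb
  have hqa : q.eval a ≠ 0 := by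
    intro h; apply hga; rw [hq]; simp [h]
  have hqc : ∀ c ∈ Set.uIcc a b, q.eval c ≠ 0 := by
    intro c hc h
    rw [Set.uIcc_of_le hab.le] at hc
    rcases hc.1.eq_or_lt with rfl | h1
    · exact hqa h
    rcases hc.2.eq_or_lt with rfl | h2
    · exact hqb h
    exact hno c h1 h2 (by rw [hg, hq]; simp [h])
  have hs := hR.sign_eval_eq hqc
  set w : R[X] := (C ((k : R) + 1) * (X - C b) + C ((l : R) + 1) * (X - C a)) * q
    + (X - C a) * (X - C b) * derivative q with hw
  have hd : f.derivative = (X - C a) ^ k * (X - C b) ^ l * w := by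
    rw [hg, hq, hw]
    simp only [derivative_mul, derivative_X_sub_C_pow, Nat.add_sub_cancel]
    simp only [map_add, map_natCast, Nat.cast_add, Nat.cast_one, map_one]
    ring
  have hwa : w.eval a = -((k + 1) * (b - a)) * q.eval a := by simp [hw]; ring
  have hwb : w.eval b = ((l + 1) * (b - a)) * q.eval b := by simp [hw]
  have hpos : 0 < q.eval a * q.eval b := by
    rw [← sign_eq_one_iff, sign_mul, hs, ← sign_mul, sign_eq_one_iff]
    exact mul_self_pos.2 hqb
  have hneg : w.eval a * w.eval b < 0 := by
    rw [hwa, hwb]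
    have h1 : 0 < ((k : R) + 1) * (b - a) * ((l + 1) * (b - a)) := by
      have := sub_pos.2 hab
      positivity
    nlinarith [mul_pos h1 hpos]
  obtain ⟨c, h1, h2, h3⟩ := hR w a b hab hneg
  exact ⟨c, h1, h2, by rw [hd]; simp [h3]⟩

theorem rolle (hR : PolynomialIVT R) {f : R[X]} {a b : R}
    (hab : a < b) (ha : f.eval a = 0) (hb : f.eval b = 0) :
    ∃ c, a < c ∧ c < b ∧ f.derivative.eval c = 0 := by
  by_cases hf : f = 0
  · obtain ⟨c, h1, h2⟩ := exists_between hab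
    exact ⟨c, h1, h2, by simp [hf]⟩
  classical
  let S := f.roots.toFinset.filter (fun x => a < x)
  have hS : ∀ x, x ∈ S ↔ f.eval x = 0 ∧ a < x := by
    intro x; simp [S, hf]
  have hne : S.Nonempty := ⟨b, (hS b).2 ⟨hb, hab⟩⟩
  have hm := (hS _).1 (S.min'_mem hne)
  obtain ⟨c, h1, h2, h3⟩ := hR.rolle_of_consecutive hf hm.2 ha hm.1 (by
    intro c h1 h2 h3
    exact absurd (S.min'_le c ((hS c).2 ⟨h3, h1⟩)) (not_le.2 h2))
  exact ⟨c, h1, h2.trans_le (S.min'_le b ((hS b).2 ⟨hb, hab⟩)), h3⟩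

theorem exists_eval_sub_eq (hR : PolynomialIVT R) (f : R[X]) {a b : R} (hab : a < b) :
    ∃ c, a < c ∧ c < b ∧ f.eval b - f.eval a = (b - a) * f.derivative.eval c := by
  obtain ⟨c, h1, h2, h3⟩ := hR.rolle
    (f := C (b - a) * (f - C (f.eval a)) - C (f.eval b - f.eval a) * (X - C a)) hab
    (by simp) (by simp; ring)
  refine ⟨c, h1, h2, ?_⟩
  simp at h3
  linear_combination -h3

theorem eval_lt_eval (hR : PolynomialIVT R) {f : R[X]} {a b : R} (hab : a < b)
    (h : ∀ c, a < c → c < b → 0 < f.derivative.eval c) : f.eval a < f.eval b := by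
  obtain ⟨c, h1, h2, h3⟩ := hR.exists_eval_sub_eq f hab
  have := mul_pos (sub_pos.2 hab) (h c h1 h2)
  linarith

end PolynomialIVT

section OrderedFieldPair

variable {E R S : Type*} [Field E] [LinearOrder E] [IsStrictOrderedRing E]
  [Field R] [LinearOrder R] [IsStrictOrderedRing R]
  [Field S] [LinearOrder S] [IsStrictOrderedRing S]

omit [IsStrictOrderedRing E] [IsStrictOrderedRing R] in
theorem StrictMono.sign_ringHom_apply {φ : E →+* R} (hφ : StrictMono φ) (x : E) :
    SignType.sign (φ x) = SignType.sign x := by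
  rcases lt_trichotomy x 0 with h | rfl | h
  · rw [sign_neg h, sign_neg (by simpa using hφ h)]
  · simp
  · rw [sign_pos h, sign_pos (by simpa using hφ h)]

theorem StrictMono.abs_ringHom_apply {φ : E →+* R} (hφ : StrictMono φ) (x : E) :
    |φ x| = φ |x| := by
  rcases le_total 0 x with h | h
  · rw [abs_of_nonneg h, abs_of_nonneg (by simpa using hφ.monotone h)]
  · rw [abs_of_nonpos h, abs_of_nonpos (by simpa using hφ.monotone h), map_neg]

omit [IsStrictOrderedRing E] [IsStrictOrderedRing R] in
theorem StrictMono.sign_eval_map {φ : E →+* R} (hφ : StrictMono φ) (f : E[X]) (c : E) :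
    SignType.sign ((f.map φ).eval (φ c)) = SignType.sign (f.eval c) := by
  rw [eval_map_apply, hφ.sign_ringHom_apply]

/-- The roots in `R` of a polynomial over `E` all come from `E`. -/
def RootsInRange (φ : E →+* R) (g : E[X]) : Prop :=
  ∀ x, (g.map φ).eval x = 0 → x ∈ Set.range φ

/-- `α` and `β` fill the same cut of `E`. -/
def SameCut (φ : E →+* R) (ψ : E →+* S) (α : R) (β : S) : Prop :=
  ∀ c, (φ c < α ↔ ψ c < β) ∧ (α < φ c ↔ β < ψ c)

omit [LinearOrder E] [IsStrictOrderedRing E] [IsStrictOrderedRing R] [IsStrictOrderedRing S] in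
theorem SameCut.symm {φ : E →+* R} {ψ : E →+* S} {α : R} {β : S}
    (h : SameCut φ ψ α β) : SameCut ψ φ β α :=
  fun c => ⟨(h c).1.symm, (h c).2.symm⟩

omit [LinearOrder E] [IsStrictOrderedRing E] [IsStrictOrderedRing R] [IsStrictOrderedRing S] in
theorem SameCut.eq_of_eq {φ : E →+* R} {ψ : E →+* S} {β : S} {c : E}
    (h : SameCut φ ψ (φ c) β) : ψ c = β :=
  le_antisymm (not_lt.1 fun h' => lt_irrefl _ ((h c).2.2 h'))
    (not_lt.1 fun h' => lt_irrefl _ ((h c).1.2 h'))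

omit [IsStrictOrderedRing R] in
theorem exists_same_side {φ : E →+* R} (hφ : StrictMono φ) (F : Finset E) {α : R}
    (hα : α ∉ Set.range φ) : ∃ c ∉ F, ∀ r ∈ F, (r < c ↔ φ r < α) := by
  obtain ⟨c, h1, h2⟩ := Order.exists_between_finsets (F.filter (fun r => φ r < α))
    (F.filter (fun r => α < φ r)) (by
      intro x hx y hy
      simp only [Finset.mem_filter] at hx hy
      exact hφ.lt_iff_lt.1 (hx.2.trans hy.2))
  simp only [Finset.mem_filter, and_imp] at h1 h2
  have hne : ∀ r, φ r ≠ α := fun r h => hα ⟨r, h⟩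
  refine ⟨c, fun hc => ?_, fun r hr => ⟨fun h => ?_, fun h => h1 r hr h⟩⟩
  · rcases lt_or_gt_of_ne (hne c) with h | h
    · exact lt_irrefl _ (h1 c hc h)
    · exact lt_irrefl _ (h2 c hc h)
  · by_contra h'
    exact lt_asymm h (h2 r hr (lt_of_le_of_ne (not_lt.1 h') (hne r).symm))

omit [IsStrictOrderedRing E] in
theorem sign_eval_eq_of_same_side {φ : E →+* R} (hφ : StrictMono φ) (hR : PolynomialIVT R)
    {g : E[X]} (hroots : RootsInRange φ g) {α : R} (hα : α ∉ Set.range φ) {c : E}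
    (hc : g.eval c ≠ 0) (h : ∀ r, g.eval r = 0 → (r < c ↔ φ r < α)) :
    SignType.sign ((g.map φ).eval α) = SignType.sign (g.eval c) := by
  rw [← hφ.sign_eval_map]
  refine hR.sign_eval_eq fun x hx h0 => ?_
  obtain ⟨r, rfl⟩ := hroots x h0
  have hr : g.eval r = 0 := by
    rw [eval_map_apply] at h0
    exact (map_eq_zero φ).1 h0
  have hrc : r ≠ c := by rintro rfl; exact hc hr
  have hra : φ r ≠ α := fun h' => hα ⟨r, h'⟩
  have := h r hr
  rcases Set.mem_uIcc.1 hx with ⟨h1, h2⟩ | ⟨h1, h2⟩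
  · have h3 := hφ.le_iff_le.1 h2
    exact absurd (this.1 (lt_of_le_of_ne h3 hrc)) (not_lt.2 h1)
  · have h3 := hφ.le_iff_le.1 h1
    exact absurd (this.2 (lt_of_le_of_ne h2 hra)) (not_lt.2 h3)

theorem SameCut.sign_eval_eq {φ : E →+* R} {ψ : E →+* S} (hφ : StrictMono φ)
    (hψ : StrictMono ψ) (hR : PolynomialIVT R) (hS : PolynomialIVT S) {α : R} {β : S}
    (h : SameCut φ ψ α β) {g : E[X]} (h1 : RootsInRange φ g) (h2 : RootsInRange ψ g) :
    SignType.sign ((g.map φ).eval α) = SignType.sign ((g.map ψ).eval β) := by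
  by_cases hg : g = 0
  · simp [hg]
  by_cases hα : α ∈ Set.range φ
  · obtain ⟨c, rfl⟩ := hα
    rw [← h.eq_of_eq, hφ.sign_eval_map, hψ.sign_eval_map]
  have hβ : β ∉ Set.range ψ := by
    rintro ⟨c, rfl⟩
    exact hα ⟨c, h.symm.eq_of_eq⟩
  classical
  obtain ⟨c, hc, hF⟩ := exists_same_side hφ g.roots.toFinset hα
  simp only [Multiset.mem_toFinset, mem_roots hg, IsRoot.def] at hc hF
  rw [sign_eval_eq_of_same_side hφ hR h1 hα hc hF,
    sign_eval_eq_of_same_side hψ hS h2 hβ hc (fun r hr => (hF r hr).trans (h r).1)]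

theorem exists_root_bound {φ : E →+* R} (hφ : StrictMono φ) (f : E[X]) (hf : f ≠ 0) :
    ∃ B e : E, 0 ≤ B ∧ 0 < e ∧ ∀ x : R, φ B ≤ |x| → φ e ≤ |(f.map φ).eval x| := by
  induction hn : f.natDegree using Nat.strong_induction_on generalizing f with
  | _ n ih =>
  have hsplit := divX_mul_X_add f
  by_cases hd : f.divX = 0
  · rw [hd, zero_mul, zero_add] at hsplit
    have hc : f.coeff 0 ≠ 0 := by
      intro h; rw [h] at hsplit; exact hf (by simpa using hsplit.symm)
    refine ⟨0, |f.coeff 0|, le_rfl, abs_pos.2 hc, fun x _ => ?_⟩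
    rw [← hsplit]
    simp only [map_C, eval_C, coeff_C_zero]
    rw [hφ.abs_ringHom_apply]
  · have hlt : f.divX.natDegree < n := by
      rw [natDegree_divX_eq_natDegree_tsub_one]
      have : f.natDegree ≠ 0 := fun h0 => hd (by
        rw [eq_C_of_natDegree_eq_zero h0, divX_C])
      omega
    obtain ⟨B, e, hB, he, hbd⟩ := ih _ hlt f.divX hd rfl
    refine ⟨max B ((|f.coeff 0| + 1) / e), 1, le_max_of_le_left hB, one_pos, fun x hx => ?_⟩
    have hx1 := hbd x ((hφ.monotone (le_max_left _ _)).trans hx)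
    have hx2 := (hφ.monotone (le_max_right _ _)).trans hx
    have hev : (f.map φ).eval x = (f.divX.map φ).eval x * x + φ (f.coeff 0) := by
      conv_lhs => rw [← hsplit]
      simp
    have h1 : φ e * φ ((|f.coeff 0| + 1) / e) ≤ |(f.divX.map φ).eval x| * |x| :=
      mul_le_mul hx1 hx2 (by
        have : 0 ≤ (|f.coeff 0| + 1) / e := by positivity
        simpa using hφ.monotone this) (abs_nonneg _)
    rw [← map_mul, mul_div_cancel₀ _ he.ne', map_add, ← hφ.abs_ringHom_apply, map_one,
      ← abs_mul] at h1
    rw [hev, map_one]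
    have h2 := abs_sub_abs_le_abs_sub ((f.divX.map φ).eval x * x) (-φ (f.coeff 0))
    rw [abs_neg, sub_neg_eq_add] at h2
    linarith

/-- No proper extension of the pair `(φ, ψ)` preserves signs of polynomials. -/
def MaximalPair (φ : E →+* R) (ψ : E →+* S) : Prop :=
  ∀ α β, (∀ g : E[X], SignType.sign ((g.map φ).eval α) = SignType.sign ((g.map ψ).eval β)) →
    ∃ c, φ c = α ∧ ψ c = β

omit [LinearOrder E] [IsStrictOrderedRing E] [IsStrictOrderedRing R] [IsStrictOrderedRing S] in
theorem MaximalPair.symm {φ : E →+* R} {ψ : E →+* S} (h : MaximalPair φ ψ) :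
    MaximalPair ψ φ := fun α β hg => by
  obtain ⟨c, h1, h2⟩ := h β α (fun g => (hg g).symm)
  exact ⟨c, h2, h1⟩

omit [IsStrictOrderedRing E] in
theorem sign_eval_eq_of_mem_Ioo {φ : E →+* R} (hφ : StrictMono φ) (hR : PolynomialIVT R)
    {g : E[X]} (hg : RootsInRange φ g) {u v : E}
    (hno : ∀ r, u < r → r < v → g.eval r ≠ 0) {x y : R}
    (hx : x ∈ Set.Ioo (φ u) (φ v)) (hy : y ∈ Set.Ioo (φ u) (φ v)) :
    SignType.sign ((g.map φ).eval x) = SignType.sign ((g.map φ).eval y) := by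
  refine hR.sign_eval_eq fun z hz h0 => ?_
  have hz' := Set.ordConnected_Ioo.uIcc_subset hx hy hz
  obtain ⟨r, rfl⟩ := hg z h0
  rw [eval_map_apply] at h0
  exact hno r (hφ.lt_iff_lt.1 hz'.1) (hφ.lt_iff_lt.1 hz'.2) ((map_eq_zero φ).1 h0)

theorem mem_range_of_root {φ : E →+* R} {ψ : E →+* S} (hφ : StrictMono φ)
    (hψ : StrictMono ψ) (hR : PolynomialIVT R) (hS : PolynomialIVT S)
    (hmax : MaximalPair φ ψ) {f : E[X]} (hf : f ≠ 0)
    (ih : ∀ g : E[X], g.natDegree < f.natDegree → g ≠ 0 → RootsInRange φ g ∧ RootsInRange ψ g)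
    {α : R} (hα : (f.map φ).eval α = 0) : α ∈ Set.range φ := by
  by_contra hrange
  have hdeg : f.natDegree ≠ 0 := by
    intro h0
    rw [eq_C_of_natDegree_eq_zero h0] at hα hf
    simp only [map_C, eval_C, map_eq_zero] at hα
    exact hf (by rw [hα, C_0])
  have hdlt := natDegree_derivative_lt hdeg
  have hd0 : derivative f ≠ 0 := fun h => hdeg (derivative_eq_zero.1 h)
  have hdα : ((derivative f).map φ).eval α ≠ 0 := fun h =>
    hrange ((ih _ hdlt hd0).1 α h)
  wlog hpos : 0 < ((derivative f).map φ).eval α generalizing f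
  · refine this (f := -f) (neg_ne_zero.2 hf) (by simpa using ih) (by simpa using hα)
      (by simpa using hdeg) (by simpa using hdlt) (by simpa using hd0) (by simpa using hdα) ?_
    have := lt_of_le_of_ne (not_lt.1 hpos) hdα
    simpa using this
  obtain ⟨hroot1, hroot2⟩ := ih _ hdlt hd0
  obtain ⟨B, e, hB, he, hbd⟩ := exists_root_bound hφ f hf
  have hαB : |α| < φ B := by
    by_contra h
    have := hbd α (not_lt.1 h)
    rw [hα, abs_zero] at this
    exact absurd (hφ he) (by simpa using this)
  rw [abs_lt, ← map_neg] at hαB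
  classical
  let F : Finset E := insert B (insert (-B) (derivative f).roots.toFinset)
  have hne : ∀ r, φ r ≠ α := fun r h => hrange ⟨r, h⟩
  have hlo : (F.filter (fun r => φ r < α)).Nonempty := 
    ⟨-B, Finset.mem_filter.2 ⟨by simp [F], hαB.1⟩⟩
  have hhi : (F.filter (fun r => α < φ r)).Nonempty := 
    ⟨B, Finset.mem_filter.2 ⟨by simp [F], hαB.2⟩⟩
  obtain ⟨u, hu⟩ : ∃ u, u = Finset.max' _ hlo := ⟨_, rfl⟩
  obtain ⟨v, hv⟩ : ∃ v, v = Finset.min' _ hhi := ⟨_, rfl⟩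
  have huα : φ u < α := by
    have := Finset.max'_mem _ hlo
    rw [← hu] at this
    exact (Finset.mem_filter.1 this).2
  have hvα : α < φ v := by
    have := Finset.min'_mem _ hhi
    rw [← hv] at this
    exact (Finset.mem_filter.1 this).2
  have hno : ∀ r, u < r → r < v → (derivative f).eval r ≠ 0 := by
    intro r h1 h2 h0
    have hrF : r ∈ F := by simp [F, hd0, h0]
    rcases lt_or_gt_of_ne (hne r) with h | h
    · have := Finset.le_max' (F.filter (fun r => φ r < α)) r
        (Finset.mem_filter.2 ⟨hrF, h⟩)
      rw [← hu] at this
      exact absurd h1 (not_lt.2 this)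
    · have := Finset.min'_le (F.filter (fun r => α < φ r)) r
        (Finset.mem_filter.2 ⟨hrF, h⟩)
      rw [← hv] at this
      exact absurd h2 (not_lt.2 this)
  have huv : u < v := hφ.lt_iff_lt.1 (huα.trans hvα)
  obtain ⟨w, huw, hwv⟩ := exists_between huv
  have hw : 0 < (derivative f).eval w := by
    rw [← sign_eq_one_iff, ← hφ.sign_eval_map,
      sign_eval_eq_of_mem_Ioo hφ hR hroot1 hno ⟨hφ huw, hφ hwv⟩ ⟨huα, hvα⟩, sign_pos hpos]
  have hmono1 : ∀ x y, φ u ≤ x → x < y → y ≤ φ v → (f.map φ).eval x < (f.map φ).eval y := by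
    intro x y h1 h2 h3
    refine hR.eval_lt_eval h2 fun c h4 h5 => ?_
    rw [derivative_map, ← sign_eq_one_iff, sign_eval_eq_of_mem_Ioo hφ hR hroot1 hno
      ⟨h1.trans_lt h4, h5.trans_le h3⟩ ⟨hφ huw, hφ hwv⟩, hφ.sign_eval_map, sign_pos hw]
  have hmono2 : ∀ x y, ψ u ≤ x → x < y → y ≤ ψ v → (f.map ψ).eval x < (f.map ψ).eval y := by
    intro x y h1 h2 h3
    refine hS.eval_lt_eval h2 fun c h4 h5 => ?_
    rw [derivative_map, ← sign_eq_one_iff, sign_eval_eq_of_mem_Ioo hψ hS hroot2 hno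
      ⟨h1.trans_lt h4, h5.trans_le h3⟩ ⟨hψ huw, hψ hwv⟩, hψ.sign_eval_map, sign_pos hw]
  have hneg1 : ∀ c, (f.map φ).eval (φ c) < 0 ↔ (f.map ψ).eval (ψ c) < 0 := fun c => by
    rw [← sign_eq_neg_one_iff, hφ.sign_eval_map, ← sign_eq_neg_one_iff, hψ.sign_eval_map]
  have hpos1 : ∀ c, 0 < (f.map φ).eval (φ c) ↔ 0 < (f.map ψ).eval (ψ c) := fun c => by
    rw [← sign_eq_one_iff, hφ.sign_eval_map, ← sign_eq_one_iff, hψ.sign_eval_map]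
  have hu2 := (hneg1 u).1 (hα ▸ hmono1 _ _ le_rfl huα hvα.le)
  have hv2 := (hpos1 v).1 (hα ▸ hmono1 _ _ huα.le hvα le_rfl)
  obtain ⟨β, huβ, hvβ, hβ⟩ := hS _ _ _ (hψ huv) (mul_neg_of_neg_of_pos hu2 hv2)
  have hcut : SameCut φ ψ α β := by
    intro c
    rcases le_or_gt c u with hcu | huc
    · have h1 := (hφ.monotone hcu).trans_lt huα
      have h2 := (hψ.monotone hcu).trans_lt huβ
      simp [h1, h2, h1.not_gt, h2.not_gt]
    rcases le_or_gt v c with hvc | hcv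
    · have h1 := hvα.trans_le (hφ.monotone hvc)
      have h2 := hvβ.trans_le (hψ.monotone hvc)
      simp [h1, h2, h1.not_gt, h2.not_gt]
    have hβlt : (f.map ψ).eval (ψ c) < 0 → ψ c < β := fun h => by
      by_contra h'
      rcases (not_lt.1 h').eq_or_lt with h3 | h3
      · rw [← h3, hβ] at h; exact lt_irrefl _ h
      · have := hmono2 _ _ huβ.le h3 (hψ hcv).le
        rw [hβ] at this
        exact lt_asymm h this
    have hβgt : 0 < (f.map ψ).eval (ψ c) → β < ψ c := fun h => by
      by_contra h'
      rcases (not_lt.1 h').eq_or_lt with h3 | h3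
      · rw [h3, hβ] at h; exact lt_irrefl _ h
      · have := hmono2 _ _ (hψ huc).le h3 hvβ.le
        rw [hβ] at this
        exact lt_asymm h this
    rcases lt_or_gt_of_ne (hne c) with h | h
    · have h2 := hβlt ((hneg1 c).1 (hα ▸ hmono1 _ _ (hφ huc).le h hvα.le))
      simp [h, h2, h.not_gt, h2.not_gt]
    · have h2 := hβgt ((hpos1 c).1 (hα ▸ hmono1 _ _ huα.le h (hφ hcv).le))
      simp [h, h2, h.not_gt, h2.not_gt]
  obtain ⟨c, hc, -⟩ := hmax α β fun g => by
    have h1 : (g.map φ).eval α = ((g % f).map φ).eval α := by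
      conv_lhs => rw [← EuclideanDomain.div_add_mod g f]
      simp [hα]
    have h2 : (g.map ψ).eval β = ((g % f).map ψ).eval β := by
      conv_lhs => rw [← EuclideanDomain.div_add_mod g f]
      simp [hβ]
    rw [h1, h2]
    by_cases h0 : g % f = 0
    · simp [h0]
    · obtain ⟨h3, h4⟩ := ih _ (natDegree_mod_lt g hdeg) h0
      exact hcut.sign_eval_eq hφ hψ hR hS h3 h4
  exact hne c hc

theorem MaximalPair.rootsInRange {φ : E →+* R} {ψ : E →+* S} (hφ : StrictMono φ)
    (hψ : StrictMono ψ) (hR : PolynomialIVT R) (hS : PolynomialIVT S)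
    (hmax : MaximalPair φ ψ) (f : E[X]) (hf : f ≠ 0) :
    RootsInRange φ f ∧ RootsInRange ψ f := by
  induction hn : f.natDegree using Nat.strong_induction_on generalizing f with
  | _ n ih =>
  subst hn
  have ih' : ∀ g : E[X], g.natDegree < f.natDegree → g ≠ 0 →
      RootsInRange φ g ∧ RootsInRange ψ g := fun g hg h0 => ih _ hg g h0 rfl
  exact ⟨fun α hα => mem_range_of_root hφ hψ hR hS hmax hf ih' hα,
    fun β hβ => mem_range_of_root hψ hφ hS hR hmax.symm hf (fun g hg h0 => (ih' g hg h0).symm) hβ⟩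

theorem MaximalPair.exists_sign_eval_eq {φ : E →+* R} {ψ : E →+* S} (hφ : StrictMono φ)
    (hψ : StrictMono ψ) (hR : PolynomialIVT R) (hS : PolynomialIVT S)
    (hmax : MaximalPair φ ψ) (T : Finset E[X]) (α : R) :
    ∃ c : E, ∀ g ∈ T, SignType.sign ((g.map φ).eval α) = SignType.sign ((g.map ψ).eval (ψ c)) := by
  by_cases hα : α ∈ Set.range φ
  · obtain ⟨c, rfl⟩ := hα
    exact ⟨c, fun g _ => by rw [hφ.sign_eval_map, hψ.sign_eval_map]⟩
  classical
  obtain ⟨c, hc, hF⟩ := exists_same_side hφ (T.biUnion fun g => g.roots.toFinset) hα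
  refine ⟨c, fun g hg => ?_⟩
  by_cases h0 : g = 0
  · simp [h0]
  have hmem : ∀ r, g.eval r = 0 → r ∈ T.biUnion fun g => g.roots.toFinset := fun r hr =>
    Finset.mem_biUnion.2 ⟨g, hg, by simp [h0, hr]⟩
  rw [hψ.sign_eval_map, sign_eval_eq_of_same_side hφ hR
    (hmax.rootsInRange hφ hψ hR hS g h0).1 hα (fun h => hc (hmem c h))
    (fun r hr => hF r (hmem r hr))]

end OrderedFieldPair

section MaximalExtension

variable {R S : Type*} [Field R] [LinearOrder R] [IsStrictOrderedRing R]
  [Field S] [LinearOrder S] [IsStrictOrderedRing S]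

/-- The two components of every element of `G` have the same sign, so `G` is the graph of an
order isomorphism between subrings of `R` and `S`. -/
def SignCompatible (G : Subring (R × S)) : Prop :=
  ∀ x ∈ G, SignType.sign x.1 = SignType.sign x.2

omit [IsStrictOrderedRing R] [IsStrictOrderedRing S] in
theorem SignCompatible.exists_maximal {G₀ : Subring (R × S)} (h₀ : SignCompatible G₀) :
    ∃ G : Subring (R × S), G₀ ≤ G ∧ Maximal SignCompatible G := by
  refine zorn_le_nonempty₀ {G : Subring (R × S) | SignCompatible G} ?_ G₀ h₀
  intro c hc hchain G hG
  refine ⟨sSup c, fun x hx => ?_, fun z hz => le_sSup hz⟩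
  rw [Subring.mem_sSup_of_directedOn ⟨G, hG⟩ hchain.directedOn] at hx
  obtain ⟨H, hH, hxH⟩ := hx
  exact hc hH x hxH

omit [IsStrictOrderedRing R] [IsStrictOrderedRing S] in
theorem mem_of_maximal_signCompatible {G : Subring (R × S)} (hG : Maximal SignCompatible G)
    {p : R × S}
    (h : ∀ g : G[X], SignType.sign (eval₂ ((RingHom.fst R S).comp G.subtype) p.1 g) =
      SignType.sign (eval₂ ((RingHom.snd R S).comp G.subtype) p.2 g)) : p ∈ G := by
  have hle : G ≤ (eval₂RingHom G.subtype p).range := fun x hx =>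
    ⟨C ⟨x, hx⟩, by simp⟩
  refine hG.2 (y := (eval₂RingHom G.subtype p).range) ?_ hle ⟨X, by simp⟩
  rintro _ ⟨g, rfl⟩
  have h1 := hom_eval₂ g G.subtype (RingHom.fst R S) p
  have h2 := hom_eval₂ g G.subtype (RingHom.snd R S) p
  simp only [RingHom.coe_fst, RingHom.coe_snd] at h1 h2
  rw [coe_eval₂RingHom, h1, h2]
  exact h g

theorem sign_eval₂_inv {A K : Type*} [CommRing A] [Field K] [LinearOrder K]
    [IsStrictOrderedRing K] (i : A →+* K) {a : K} (ha : a ≠ 0) (g : A[X]) :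
    SignType.sign (eval₂ i a⁻¹ g) =
      SignType.sign (eval₂ i a (reverse g)) * SignType.sign a ^ g.natDegree := by
  let _ : Invertible a⁻¹ := invertibleOfNonzero (inv_ne_zero ha)
  have h := eval₂_reverse_mul_pow i a⁻¹ g
  rw [invOf_eq_inv, inv_inv] at h
  rw [← h, sign_mul, sign_pow]
  congr 2
  rcases lt_or_gt_of_ne ha with h | h
  · rw [sign_neg h, sign_neg (inv_lt_zero.2 h)]
  · rw [sign_pos h, sign_pos (inv_pos.2 h)]

theorem inv_mem_of_maximal_signCompatible {G : Subring (R × S)}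
    (hG : Maximal SignCompatible G) {p : R × S} (hp : p ∈ G) : (p.1⁻¹, p.2⁻¹) ∈ G := by
  have hsign := hG.1 p hp
  by_cases h1 : p.1 = 0
  · have h2 : p.2 = 0 := by
      rw [h1, sign_zero, eq_comm, sign_eq_zero_iff] at hsign
      exact hsign
    rw [h1, h2, _root_.inv_zero, _root_.inv_zero]
    exact G.zero_mem
  have h2 : p.2 ≠ 0 := by
    intro h2
    rw [h2, sign_zero, sign_eq_zero_iff] at hsign
    exact h1 hsign
  refine mem_of_maximal_signCompatible hG fun g => ?_
  rw [sign_eval₂_inv _ h1, sign_eval₂_inv _ h2, hsign]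
  congr 1
  have e1 := hom_eval₂ g.reverse (RingHom.id G) ((RingHom.fst R S).comp G.subtype) ⟨p, hp⟩
  have e2 := hom_eval₂ g.reverse (RingHom.id G) ((RingHom.snd R S).comp G.subtype) ⟨p, hp⟩
  simp only [RingHom.comp_id, RingHom.comp_apply, Subring.subtype_apply, RingHom.coe_fst,
    RingHom.coe_snd] at e1 e2
  rw [← e1, ← e2]
  exact hG.1 _ (SetLike.coe_mem _)

theorem exists_maximalPair {R : Type u} {S : Type*} [Field R] [LinearOrder R]
    [IsStrictOrderedRing R] [Field S] [LinearOrder S] [IsStrictOrderedRing S]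
    {A : Type*} [CommRing A] (ρ : A →+* R) (σ : A →+* S)
    (h : ∀ a, SignType.sign (ρ a) = SignType.sign (σ a)) :
    ∃ (E : Type u) (_ : Field E) (_ : LinearOrder E) (_ : IsStrictOrderedRing E)
      (φ : E →+* R) (ψ : E →+* S) (ι : A →+* E), StrictMono φ ∧ StrictMono ψ ∧
      MaximalPair φ ψ ∧ φ.comp ι = ρ ∧ ψ.comp ι = σ := by
  obtain ⟨G, hle, hG⟩ := SignCompatible.exists_maximal (G₀ := (ρ.prod σ).range) (by
    rintro _ ⟨a, rfl⟩; exact h a)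
  let f : G →+* R := (RingHom.fst R S).comp G.subtype
  let s : G →+* S := (RingHom.snd R S).comp G.subtype
  have hsign : ∀ x : G, SignType.sign (f x) = SignType.sign (s x) := fun x => hG.1 x x.2
  have hf : Function.Injective f := by
    rw [injective_iff_map_eq_zero]
    intro x hx
    have h2 := hsign x
    rw [hx, sign_zero, eq_comm, sign_eq_zero_iff] at h2
    exact Subtype.ext (Prod.ext hx h2)
  let E : Subfield R := { f.range with
    inv_mem' := by
      rintro _ ⟨x, rfl⟩
      exact ⟨⟨_, inv_mem_of_maximal_signCompatible hG x.2⟩, rfl⟩ }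
  let e : G ≃+* E := RingEquiv.ofBijective (f.codRestrict E fun x => ⟨x, rfl⟩)
    ⟨fun x y hxy => hf (congrArg Subtype.val hxy), by
      rintro ⟨_, x, rfl⟩; exact ⟨x, rfl⟩⟩
  have he : ∀ x : G, ((e x : E) : R) = f x := fun x => rfl
  let ψ : E →+* S := s.comp (e.symm : E →+* G)
  have hψe : ∀ x : G, ψ (e x) = s x := fun x => by simp [ψ]
  have hψsign : ∀ x : E, SignType.sign (ψ x) = SignType.sign (x : R) := fun x => by
    obtain ⟨y, rfl⟩ := e.surjective x
    rw [hψe, he, hsign]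
  let ι : A →+* E := (e : G →+* E).comp
    ((ρ.prod σ).codRestrict G fun a => hle ⟨a, rfl⟩)
  refine ⟨E, inferInstance, inferInstance, inferInstance, E.subtype, ψ, ι,
    fun x y hxy => hxy, fun x y hxy => ?_, fun α β hg => ?_, ?_, ?_⟩
  · rw [← sub_pos, ← map_sub, ← sign_eq_one_iff, hψsign, sign_eq_one_iff]
    simpa using hxy
  · have hmem : (α, β) ∈ G := by
      refine mem_of_maximal_signCompatible hG fun g => ?_
      have := hg (g.map (e : G →+* E))
      rw [Polynomial.map_map, Polynomial.map_map, eval_map, eval_map] at this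
      have e₁ : E.subtype.comp (e : G →+* E) = f := rfl
      have e₂ : ψ.comp (e : G →+* E) = s := RingHom.ext hψe
      rwa [e₁, e₂] at this
    exact ⟨e ⟨_, hmem⟩, rfl, hψe _⟩
  · ext a; rfl
  · ext a
    exact hψe _

end MaximalExtension

section Transfer

theorem polynomialIVT_real : PolynomialIVT ℝ := by
  intro f a b hab h
  have hc : ContinuousOn (fun x => f.eval x) (Set.Icc a b) := f.continuous.continuousOn
  rcases mul_neg_iff.1 h with ⟨h1, h2⟩ | ⟨h1, h2⟩
  · obtain ⟨c, hc, h0⟩ := intermediate_value_Ioo' hab.le hc ⟨h2, h1⟩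
    exact ⟨c, hc.1, hc.2, h0⟩
  · obtain ⟨c, hc, h0⟩ := intermediate_value_Ioo hab.le hc ⟨h1, h2⟩
    exact ⟨c, hc.1, hc.2, h0⟩

theorem germ_eval_map {I : Type*} {U : Ultrafilter I} (F : (I → ℝ)[X]) (a : I → ℝ) :
    (F.map (Filter.Germ.coeRingHom (U : Filter I))).eval (a : Filter.Germ (U : Filter I) ℝ) =
      ((fun i => (F.map (Pi.evalRingHom (fun _ => ℝ) i)).eval (a i) : I → ℝ) :
        Filter.Germ (U : Filter I) ℝ) := by
  have h := eval_map_apply (Filter.Germ.coeRingHom (R := ℝ) (U : Filter I)) (p := F) a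
  refine h.trans ?_
  refine congrArg (Filter.Germ.coeRingHom (R := ℝ) (U : Filter I)) ?_
  funext i
  exact (eval_map_apply (Pi.evalRingHom (fun _ => ℝ) i) (p := F) a).symm

theorem polynomialIVT_germ {I : Type*} (U : Ultrafilter I) :
    PolynomialIVT (Filter.Germ (U : Filter I) ℝ) := by
  intro f a b hab h
  obtain ⟨F, rfl⟩ := Polynomial.map_surjective (Filter.Germ.coeRingHom (R := ℝ) (U : Filter I))
    Quotient.mk_surjective f
  induction a using Filter.Germ.inductionOn with | _ a =>
  induction b using Filter.Germ.inductionOn with | _ b =>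
  rw [germ_eval_map, germ_eval_map, ← Filter.Germ.coe_mul, ← Filter.Germ.coe_zero,
    Filter.Germ.coe_lt] at h
  rw [Filter.Germ.coe_lt] at hab
  have hex : ∀ᶠ i in (U : Filter I), ∃ c, a i < c ∧ c < b i ∧
      (F.map (Pi.evalRingHom (fun _ => ℝ) i)).eval c = 0 := by
    filter_upwards [h, hab] with i h1 h2
    exact polynomialIVT_real _ _ _ h2 h1
  obtain ⟨c, hc⟩ := hex.choice
  refine ⟨(c : Filter.Germ (U : Filter I) ℝ), ?_, ?_, ?_⟩
  · rw [Filter.Germ.coe_lt]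
    exact hc.mono fun i h => h.1
  · rw [Filter.Germ.coe_lt]
    exact hc.mono fun i h => h.2.1
  · rw [germ_eval_map, ← Filter.Germ.coe_zero, Filter.Germ.coe_eq]
    exact hc.mono fun i h => h.2.2

theorem germ_sign_eq_iff {I : Type*} {U : Ultrafilter I} (f : I → ℝ) (s : SignType) :
    SignType.sign (f : Filter.Germ (U : Filter I) ℝ) = s ↔
      ∀ᶠ i in (U : Filter I), SignType.sign (f i) = s := by
  cases s
  · change _ = 0 ↔ ∀ᶠ i in (U : Filter I), _ = 0
    simp only [sign_eq_zero_iff]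
    rw [← Filter.Germ.coe_zero, Filter.Germ.coe_eq]
    rfl
  · simp only [SignType.neg_eq_neg_one, sign_eq_neg_one_iff]
    rw [← Filter.Germ.coe_zero, Filter.Germ.coe_lt]
    rfl
  · change _ = 1 ↔ ∀ᶠ i in (U : Filter I), _ = 1
    simp only [sign_eq_one_iff]
    rw [← Filter.Germ.coe_zero, Filter.Germ.coe_lt]
    rfl

theorem eval₂Hom_cons {A B : Type*} [CommRing A] [CommRing B] (ρ : A →+* B) {m : ℕ} (α : B)
    (x : Fin m → B) (h : MvPolynomial (Fin (m + 1)) A) :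
    MvPolynomial.eval₂Hom ρ (Fin.cons α x) h =
      eval₂ (MvPolynomial.eval₂Hom ρ x) α (MvPolynomial.finSuccEquiv A m h) := by
  have : MvPolynomial.eval₂Hom ρ (Fin.cons α x) =
      (eval₂RingHom (MvPolynomial.eval₂Hom ρ x) α).comp
        (MvPolynomial.finSuccEquiv A m : MvPolynomial (Fin (m + 1)) A →+* _) := by
    refine MvPolynomial.ringHom_ext (fun r => ?_) (fun i => ?_)
    · simp [MvPolynomial.finSuccEquiv_apply]
    · refine Fin.cases ?_ (fun j => ?_) i
      · simp [MvPolynomial.finSuccEquiv_X_zero]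
      · simp [MvPolynomial.finSuccEquiv_X_succ]
  exact congrArg (fun g => g h) this

variable {R : Type*} [Field R] [LinearOrder R] [IsStrictOrderedRing R]

theorem strictMono_ringHom_real (ρ : ℝ →+* R) : StrictMono ρ := by
  intro x y hxy
  rw [← sub_pos, ← map_sub, ← Real.mul_self_sqrt (sub_pos.2 hxy).le, map_mul]
  exact mul_self_pos.2 ((map_ne_zero ρ).2 (Real.sqrt_pos.2 (sub_pos.2 hxy)).ne')

omit [IsStrictOrderedRing R] in
theorem exists_ultrafilter_sign_eq {m : ℕ} (ρ : ℝ →+* R) (x : Fin m → R)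
    (H : ∀ T : Finset (MvPolynomial (Fin m) ℝ), ∃ a : Fin m → ℝ, ∀ h ∈ T,
      SignType.sign (MvPolynomial.eval a h) = SignType.sign (MvPolynomial.eval₂Hom ρ x h)) :
    ∃ U : Ultrafilter (Fin m → ℝ), ∀ h : MvPolynomial (Fin m) ℝ, ∀ᶠ a in (U : Filter _),
      SignType.sign (MvPolynomial.eval a h) = SignType.sign (MvPolynomial.eval₂Hom ρ x h) := by
  classical
  let Z : MvPolynomial (Fin m) ℝ → Set (Fin m → ℝ) := fun h =>
    {a | SignType.sign (MvPolynomial.eval a h) = SignType.sign (MvPolynomial.eval₂Hom ρ x h)}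
  obtain ⟨U, hU⟩ := Ultrafilter.exists_ultrafilter_of_finite_inter_nonempty (Set.range Z) (by
    intro T hT
    obtain ⟨T', rfl⟩ : ∃ T' : Finset (MvPolynomial (Fin m) ℝ), T = T'.image Z := by
      obtain ⟨s, hs⟩ := Finset.subset_set_image_iff.1
        (by simpa using hT : (T : Set _) ⊆ Z '' Set.univ)
      exact ⟨s, hs.2.symm⟩
    obtain ⟨a, ha⟩ := H T'
    exact ⟨a, by simpa [Z] using ha⟩)
  exact ⟨U, fun h => hU ⟨h, rfl⟩⟩

theorem exists_real_point_sign_eq (hR : PolynomialIVT R) (ρ : ℝ →+* R) (m : ℕ) (x : Fin m → R)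
    (T : Finset (MvPolynomial (Fin m) ℝ)) : ∃ a : Fin m → ℝ, ∀ h ∈ T,
      SignType.sign (MvPolynomial.eval a h) = SignType.sign (MvPolynomial.eval₂Hom ρ x h) := by
  induction m with
  | zero =>
    refine ⟨0, fun h _ => ?_⟩
    rw [MvPolynomial.eq_C_of_isEmpty h, MvPolynomial.eval_C, MvPolynomial.eval₂Hom_C,
      (strictMono_ringHom_real ρ).sign_ringHom_apply]
  | succ m ih =>
    obtain ⟨U, hU⟩ := exists_ultrafilter_sign_eq ρ (Fin.tail x) (ih (Fin.tail x))
    let ev : MvPolynomial (Fin m) ℝ →+* ((Fin m → ℝ) → ℝ) :=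
      RingHom.pi fun a => MvPolynomial.eval a
    let σ : MvPolynomial (Fin m) ℝ →+* Filter.Germ (U : Filter (Fin m → ℝ)) ℝ :=
      (Filter.Germ.coeRingHom (R := ℝ) (U : Filter (Fin m → ℝ))).comp ev
    obtain ⟨E, _, _, _, φ, ψ, ι, hφ, hψ, hmax, hι1, hι2⟩ :=
      exists_maximalPair (MvPolynomial.eval₂Hom ρ (Fin.tail x)) σ (fun h =>
        ((germ_sign_eq_iff _ _).2 (hU h)).symm)
    classical
    obtain ⟨c, hc⟩ := hmax.exists_sign_eval_eq hφ hψ hR (polynomialIVT_germ U)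
      (T.image fun h => (MvPolynomial.finSuccEquiv ℝ m h).map ι) (x 0)
    obtain ⟨b, hb⟩ : ∃ b : (Fin m → ℝ) → ℝ,
        (b : Filter.Germ (U : Filter (Fin m → ℝ)) ℝ) = ψ c := Quotient.mk_surjective _
    have key : ∀ h ∈ T, ∀ᶠ a in (U : Filter (Fin m → ℝ)),
        SignType.sign (MvPolynomial.eval (Fin.cons (b a) a) h) =
          SignType.sign (MvPolynomial.eval₂Hom ρ x h) := by
      intro h hT
      have h1 := hc _ (Finset.mem_image_of_mem _ hT)
      rw [Polynomial.map_map, Polynomial.map_map, hι1, hι2, eval_map, ← eval₂Hom_cons,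
        Fin.cons_self_tail, ← Polynomial.map_map, ← hb, germ_eval_map, eq_comm,
        germ_sign_eq_iff] at h1
      filter_upwards [h1] with a ha
      rw [← ha, MvPolynomial.eval_eq_eval_mv_eval', Polynomial.map_map]
      rfl
    have hall : ∀ᶠ a in (U : Filter (Fin m → ℝ)), ∀ h ∈ T,
        SignType.sign (MvPolynomial.eval (Fin.cons (b a) a) h) =
          SignType.sign (MvPolynomial.eval₂Hom ρ x h) :=
      (Filter.eventually_all_finset T).2 key
    obtain ⟨a, ha⟩ := hall.exists
    exact ⟨_, ha⟩

end Transfer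

section RealClosure

/-- Sums of squares of polynomials of degree less than `k`. -/
noncomputable def sumSqBelow (E : Type*) [Field E] (k : ℕ) : AddSubmonoid E[X] :=
  AddSubmonoid.closure {s | ∃ h : E[X], h.natDegree < k ∧ s = h * h}

variable {E : Type*} [Field E]

theorem isSumSq_eval_of_mem_sumSqBelow {k : ℕ} {s : E[X]} (hs : s ∈ sumSqBelow E k) (x : E) :
    IsSumSq (s.eval x) := by
  induction hs using AddSubmonoid.closure_induction with
  | mem s hs => obtain ⟨h, -, rfl⟩ := hs; simp
  | zero => simp
  | add s t _ _ hs ht => simpa using hs.add ht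

theorem natDegree_le_of_mem_sumSqBelow {k : ℕ} {s : E[X]} (hs : s ∈ sumSqBelow E k) :
    s.natDegree ≤ 2 * k - 2 := by
  induction hs using AddSubmonoid.closure_induction with
  | mem s hs =>
    obtain ⟨h, hk, rfl⟩ := hs
    have := natDegree_mul_le (p := h) (q := h)
    omega
  | zero => simp
  | add s t _ _ hs ht => exact (natDegree_add_le _ _).trans (max_le hs ht)

theorem exists_coeffs_of_mem_sumSqBelow_two {s : E[X]} (hs : s ∈ sumSqBelow E 2) :
    ∃ A B c : E, IsSumSq A ∧ IsSumSq B ∧ s = C A + C c * X + C B * X ^ 2 := by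
  induction hs using AddSubmonoid.closure_induction with
  | mem s hs =>
    obtain ⟨h, hk, rfl⟩ := hs
    obtain ⟨a, b, rfl⟩ := exists_eq_X_add_C_of_natDegree_le_one (p := h) (by omega)
    refine ⟨b * b, a * a, 2 * a * b, by simp, by simp, ?_⟩
    simp only [map_mul, map_ofNat]
    ring
  | zero => exact ⟨0, 0, 0, by simp⟩
  | add s t _ _ hs ht =>
    obtain ⟨A, B, c, hA, hB, rfl⟩ := hs
    obtain ⟨A', B', c', hA', hB', rfl⟩ := ht
    refine ⟨A + A', B + B', c + c', hA.add hA', hB.add hB', ?_⟩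
    simp only [map_add]
    ring

/-- The element `f` becomes a sum of squares in every proper simple algebraic extension of `E`. -/
def BecomesSumSq (f : E) : Prop :=
  ∀ g : E[X], Irreducible g → 2 ≤ g.natDegree → ∃ s ∈ sumSqBelow E g.natDegree, g ∣ s - C f

theorem not_isSumSq_neg_one [CharZero E] {f : E} (hf : ¬ IsSumSq f) : ¬ IsSumSq (-1 : E) := by
  intro h
  apply hf
  have : f = (f + 1) / 2 * ((f + 1) / 2) + (-1) * ((f - 1) / 2 * ((f - 1) / 2)) := by
    field_simp; ring
  rw [this]
  exact (IsSumSq.mul_self _).add (h.mul (IsSumSq.mul_self _))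

section

variable {f : E} (hf : ¬ IsSumSq f) (H : BecomesSumSq f)
include H

theorem BecomesSumSq.exists_eq_add_mul {e : E} (he : ¬ IsSquare e) :
    ∃ A B : E, IsSumSq A ∧ IsSumSq B ∧ f = A + e * B := by
  have hd : (X ^ 2 - C e : E[X]).natDegree = 2 := natDegree_X_pow_sub_C
  have hirr : Irreducible (X ^ 2 - C e : E[X]) := by
    apply irreducible_of_degree_le_three_of_not_isRoot (by simp [hd])
    intro x hx
    exact he ⟨x, by simp at hx; linear_combination -hx⟩
  obtain ⟨s, hs, hdvd⟩ := H _ hirr hd.ge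
  rw [hd] at hs
  obtain ⟨A, B, c, hA, hB, rfl⟩ := exists_coeffs_of_mem_sumSqBelow_two hs
  refine ⟨A, B, hA, hB, ?_⟩
  have h1 : (X ^ 2 - C e : E[X]) ∣ C c * X + C (A + e * B - f) := by
    have : C c * X + C (A + e * B - f) =
        (C A + C c * X + C B * X ^ 2 - C f) - (X ^ 2 - C e) * C B := by
      simp only [map_add, map_mul, map_sub]; ring
    rw [this]
    exact dvd_sub hdvd (dvd_mul_right _ _)
  have h2 := eq_zero_of_dvd_of_natDegree_lt h1 (by
    have := natDegree_linear_le (a := c) (b := A + e * B - f)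
    omega)
  have h3 := congrArg (eval 0) h2
  simp at h3
  linear_combination -h3

include hf

theorem BecomesSumSq.isSquare_neg [CharZero E] : IsSquare (-f) := by
  by_contra h
  obtain ⟨A, B, hA, hB, h1⟩ := H.exists_eq_add_mul h
  have hB1 : 1 + B ≠ 0 := by
    intro h0
    apply not_isSumSq_neg_one hf
    rwa [← eq_neg_of_add_eq_zero_right h0]
  apply hf
  have : f = A * ((1 + B) * ((1 + B)⁻¹ * (1 + B)⁻¹)) := by
    field_simp; linear_combination h1
  rw [this]
  exact hA.mul ((IsSumSq.one.add hB).mul (IsSumSq.mul_self _))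

theorem BecomesSumSq.isSumSq_neg [CharZero E] {e : E} (he : ¬ IsSquare e) : IsSumSq (-e) := by
  obtain ⟨A, B, hA, hB, h1⟩ := H.exists_eq_add_mul he
  have hB0 : B ≠ 0 := by
    rintro rfl
    exact hf (by simpa [h1] using hA)
  have : -e = (A + -f) * (B * (B⁻¹ * B⁻¹)) := by
    field_simp; linear_combination h1
  rw [this]
  exact (hA.add (H.isSquare_neg hf).isSumSq).mul (hB.mul (IsSumSq.mul_self _))

theorem BecomesSumSq.isSquare_of_isSumSq [CharZero E] {e : E} (he : IsSumSq e) : IsSquare e := by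
  by_contra h
  have h0 : e ≠ 0 := by rintro rfl; exact h (by simp)
  apply not_isSumSq_neg_one hf
  have : (-1 : E) = -e * (e * (e⁻¹ * e⁻¹)) := by field_simp
  rw [this]
  exact (H.isSumSq_neg hf h).mul (he.mul (IsSumSq.mul_self _))

theorem BecomesSumSq.exists_order [CharZero E] :
    ∃ (_ : LinearOrder E) (_ : IsStrictOrderedRing E), f < 0 := by
  classical
  have hsq := fun {e} => H.isSquare_of_isSumSq hf (e := e)
  let C₀ : RingCone E :=
    { Subsemiring.sumSq E with
      eq_zero_of_mem_of_neg_mem' := by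
        intro a ha hna
        have ha : IsSumSq a := by simpa using ha
        have hna : IsSumSq (-a) := by simpa using hna
        by_contra h0
        apply not_isSumSq_neg_one hf
        have : (-1 : E) = -a * (a * (a⁻¹ * a⁻¹)) := by field_simp
        rw [this]
        exact hna.mul (ha.mul (IsSumSq.mul_self _)) }
  have hmem : ∀ x, x ∈ C₀ ↔ IsSumSq x := fun x => by
    change x ∈ Subsemiring.sumSq E ↔ _; simp
  have : HasMemOrNegMem C₀ := ⟨fun a => by
    rw [hmem, hmem]
    by_cases h : IsSquare a
    · exact Or.inl h.isSumSq
    · exact Or.inr (H.isSumSq_neg hf h)⟩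
  let _ : LinearOrder E := LinearOrder.mkOfAddGroupCone C₀
  have : IsOrderedRing E := IsOrderedRing.mkOfCone C₀
  refine ⟨inferInstance, IsOrderedRing.toIsStrictOrderedRing E, ?_⟩
  rw [← not_le]
  change ¬ f - 0 ∈ C₀
  rwa [sub_zero, hmem]

end

section

variable [LinearOrder E] [IsStrictOrderedRing E]

theorem exists_irreducible_dvd_eval_mul_neg (a b : E) (h : E[X]) (hab : h.eval a * h.eval b < 0) :
    ∃ g, Irreducible g ∧ g ∣ h ∧ g.eval a * g.eval b < 0 := by
  induction h using WfDvdMonoid.induction_on_irreducible with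
  | zero => simp at hab
  | unit u hu =>
    obtain ⟨c, hc, rfl⟩ := Polynomial.isUnit_iff.1 hu
    simp only [eval_C] at hab
    exact absurd hab (not_lt.2 (mul_self_nonneg c))
  | mul q i hq hi ih =>
    by_cases hiab : i.eval a * i.eval b < 0
    · exact ⟨i, hi, dvd_mul_right _ _, hiab⟩
    · obtain ⟨g, hg, hd, hgab⟩ := ih (by
        simp only [eval_mul] at hab
        by_contra hcon
        have := mul_nonneg (not_lt.1 hiab) (not_lt.1 hcon)
        linarith [show i.eval a * q.eval a * (i.eval b * q.eval b) =
          i.eval a * i.eval b * (q.eval a * q.eval b) by ring])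
      exact ⟨g, hg, hd.mul_left _, hgab⟩

theorem BecomesSumSq.natDegree_eq_one {f : E} (hf0 : f < 0) (H : BecomesSumSq f) (a b : E) :
    ∀ (k : ℕ) (g : E[X]), g.natDegree = k → Irreducible g → g.eval a * g.eval b < 0 →
      g.natDegree = 1 := by
  intro k
  induction k using Nat.strong_induction_on with
  | _ k ih =>
  rintro g rfl hg hab
  by_contra hne
  have h2 : 2 ≤ g.natDegree := by
    have := hg.natDegree_pos
    omega
  obtain ⟨s, hs, h, hh⟩ := H g hg h2
  have hpos : ∀ x, 0 < g.eval x * h.eval x := fun x => by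
    rw [← eval_mul, ← hh, eval_sub, eval_C]
    linarith [(isSumSq_eval_of_mem_sumSqBelow hs x).nonneg]
  have hh0 : h ≠ 0 := by rintro rfl; simpa using hpos 0
  have hdeg : g.natDegree + h.natDegree ≤ 2 * g.natDegree - 2 := by
    rw [← natDegree_mul hg.ne_zero hh0, ← hh]
    refine (natDegree_sub_le _ _).trans (max_le (natDegree_le_of_mem_sumSqBelow hs) ?_)
    simp
  have hhab : h.eval a * h.eval b < 0 := by
    by_contra hcon
    have h1 := mul_pos (hpos a) (hpos b)
    have h2 := mul_nonpos_of_nonpos_of_nonneg hab.le (not_lt.1 hcon)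
    linarith [show g.eval a * h.eval a * (g.eval b * h.eval b) =
          g.eval a * g.eval b * (h.eval a * h.eval b) by ring]
  obtain ⟨i, hi, hih, hiab⟩ := exists_irreducible_dvd_eval_mul_neg a b h hhab
  have hid : i.natDegree = 1 :=
    ih i.natDegree (by have := natDegree_le_of_dvd hih hh0; omega) i rfl hi hiab
  obtain ⟨c, hc⟩ := exists_root_of_degree_eq_one ((degree_eq_iff_natDegree_eq_of_pos one_pos).2 hid)
  have := hpos c
  rw [(hc.dvd hih : h.IsRoot c)] at this
  simp at this

theorem BecomesSumSq.polynomialIVT {f : E} (hf0 : f < 0) (H : BecomesSumSq f) :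
    PolynomialIVT E := by
  intro h a b hab hs
  obtain ⟨g, hg, hgh, hgab⟩ := exists_irreducible_dvd_eval_mul_neg a b h hs
  have h1 := H.natDegree_eq_one hf0 a b _ g rfl hg hgab
  obtain ⟨u, v, rfl⟩ := exists_eq_X_add_C_of_natDegree_le_one h1.le
  simp only [eval_add, eval_mul, eval_C, eval_X] at hgab
  have hu : u ≠ 0 := by rintro rfl; nlinarith [mul_self_nonneg v]
  have hkey : (a - (-v / u)) * (b - (-v / u)) < 0 := by
    have : (a - (-v / u)) * (b - (-v / u)) = (u * a + v) * (u * b + v) * (u⁻¹ * u⁻¹) := by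
      field_simp; ring
    rw [this]
    exact mul_neg_of_neg_of_pos hgab (mul_self_pos.2 (_root_.inv_ne_zero hu))
  refine ⟨-v / u, ?_, ?_, ?_⟩
  · by_contra hc
    nlinarith
  · by_contra hc
    nlinarith
  · refine IsRoot.dvd ?_ hgh
    simp only [IsRoot, eval_add, eval_mul, eval_C, eval_X]
    field_simp; ring

end

end RealClosure

section MaximalField

theorem isSumSq_map {A B G : Type*} [Semiring A] [Semiring B] [FunLike G A B] [RingHomClass G A B]
    (φ : G) {x : A} (hx : IsSumSq x) : IsSumSq (φ x) := by
  induction hx with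
  | zero => simp
  | sq_add a _ ih => simpa using (IsSumSq.mul_self (φ a)).add ih

variable {K L : Type*} [Field K] [Field L] [Algebra K L]

/-- The elements of `L` that are sums of squares of elements of the subfield `F`. -/
def sumSqOf (F : IntermediateField K L) : AddSubmonoid L :=
  AddSubmonoid.closure {s | ∃ y ∈ F, s = y * y}

theorem sumSqOf_mono {F F' : IntermediateField K L} (h : F ≤ F') : sumSqOf F ≤ sumSqOf F' :=
  AddSubmonoid.closure_mono fun _ ⟨y, hy, hs⟩ => ⟨y, h hy, hs⟩

theorem exists_mem_sumSqOf_of_mem_sSup {c : Set (IntermediateField K L)} (hc : IsChain (· ≤ ·) c)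
    (hne : c.Nonempty) {s : L} (hs : s ∈ sumSqOf (sSup c)) : ∃ F ∈ c, s ∈ sumSqOf F := by
  have hdir : Directed (· ≤ ·) (fun F : c => (F : IntermediateField K L)) := hc.directed
  have : Nonempty c := hne.to_subtype
  have hU : ∀ y ∈ sSup c, ∃ F ∈ c, y ∈ F := fun y hy => by
    rw [sSup_eq_iSup', ← SetLike.mem_coe, IntermediateField.coe_iSup_of_directed hdir] at hy
    simpa using hy
  induction hs using AddSubmonoid.closure_induction with
  | mem s hs =>
    obtain ⟨y, hy, rfl⟩ := hs
    obtain ⟨F, hF, hyF⟩ := hU y hy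
    exact ⟨F, hF, AddSubmonoid.subset_closure ⟨y, hyF, rfl⟩⟩
  | zero => exact ⟨_, hne.some_mem, zero_mem _⟩
  | add s t _ _ hs ht =>
    obtain ⟨F, hF, h1⟩ := hs
    obtain ⟨F', hF', h2⟩ := ht
    rcases hc.total hF hF' with h | h
    · exact ⟨F', hF', add_mem (sumSqOf_mono h h1) h2⟩
    · exact ⟨F, hF, add_mem h1 (sumSqOf_mono h h2)⟩

theorem mem_sumSqOf_of_isSumSq {F : IntermediateField K L} {x : F} (hx : IsSumSq x) :
    (x : L) ∈ sumSqOf F := by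
  induction hx with
  | zero => exact zero_mem _
  | sq_add a _ ih => exact add_mem (AddSubmonoid.subset_closure ⟨a, a.2, by simp⟩) ih

theorem isSumSq_of_mem_sumSqOf {F : IntermediateField K L} {s : L} (hs : s ∈ sumSqOf F) :
    ∃ x : F, (x : L) = s ∧ IsSumSq x := by
  induction hs using AddSubmonoid.closure_induction with
  | mem s hs =>
    obtain ⟨y, hy, rfl⟩ := hs
    exact ⟨⟨y, hy⟩ * ⟨y, hy⟩, rfl, IsSumSq.mul_self _⟩
  | zero => exact ⟨0, by simp⟩
  | add s t _ _ hs ht =>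
    obtain ⟨x, rfl, hx⟩ := hs
    obtain ⟨y, rfl, hy⟩ := ht
    exact ⟨x + y, rfl, hx.add hy⟩

theorem exists_aeval_eq_of_mem_sumSqOf_adjoin {F : IntermediateField K L} {γ : L} {g : F[X]}
    (hg : 2 ≤ g.natDegree) (hγ : aeval γ g = 0) {s : L}
    (hs : s ∈ sumSqOf ((IntermediateField.adjoin F {γ}).restrictScalars K)) :
    ∃ t ∈ sumSqBelow F g.natDegree, aeval γ t = s := by
  have halg : IsAlgebraic F γ := ⟨g, by rintro rfl; simp at hg, hγ⟩
  induction hs using AddSubmonoid.closure_induction with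
  | mem s hs =>
    obtain ⟨y, hy, rfl⟩ := hs
    have hy : y ∈ (IntermediateField.adjoin F {γ}).toSubalgebra := hy
    rw [IntermediateField.adjoin_simple_toSubalgebra_of_isAlgebraic halg,
      Algebra.adjoin_singleton_eq_range_aeval] at hy
    obtain ⟨h, rfl⟩ := hy
    have hmod : aeval γ (h % g) = aeval γ h := by
      conv_rhs => rw [← EuclideanDomain.mod_add_div h g]
      simp [hγ]
    exact ⟨h % g * (h % g),
      AddSubmonoid.subset_closure ⟨h % g, natDegree_mod_lt h (by omega), rfl⟩, by simp [hmod]⟩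
  | zero => exact ⟨0, zero_mem _, by simp⟩
  | add s t _ _ hs ht =>
    obtain ⟨x, hx, rfl⟩ := hs
    obtain ⟨y, hy, rfl⟩ := ht
    exact ⟨x + y, add_mem hx hy, by simp⟩

theorem becomesSumSq_of_maximal [IsAlgClosed L] {f : K} {F : IntermediateField K L}
    (hmax : Maximal (fun F => algebraMap K L f ∉ sumSqOf F) F) :
    BecomesSumSq (algebraMap K F f) := by
  intro g hg h2
  obtain ⟨γ, hγ⟩ := IsAlgClosed.exists_aeval_eq_zero L g (degree_pos_of_irreducible hg).ne'
  have hassoc : minpoly F γ ∣ g := minpoly.dvd F γ hγ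
  have hint : IsIntegral F γ := IsAlgebraic.isIntegral ⟨g, hg.ne_zero, hγ⟩
  have hdvd : g ∣ minpoly F γ := (minpoly.irreducible hint).dvd_symm hg hassoc
  have hγF : γ ∉ F := by
    intro hmem
    have h1 : aeval γ (X - C (⟨γ, hmem⟩ : F)) = 0 := by
      simp
    have h3 := natDegree_le_of_dvd (hdvd.trans (minpoly.dvd F γ h1)) (X_sub_C_ne_zero _)
    rw [natDegree_X_sub_C] at h3
    omega
  have hle : F ≤ (IntermediateField.adjoin F {γ}).restrictScalars K := by
    intro y hy
    exact (IntermediateField.adjoin F {γ}).algebraMap_mem ⟨y, hy⟩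
  have hmem : algebraMap K L f ∈ sumSqOf ((IntermediateField.adjoin F {γ}).restrictScalars K) := by
    by_contra hcon
    exact hγF (hmax.2 hcon hle (IntermediateField.mem_adjoin_simple_self F γ))
  obtain ⟨t, ht, hts⟩ := exists_aeval_eq_of_mem_sumSqOf_adjoin h2 hγ hmem
  refine ⟨t, ht, hdvd.trans (minpoly.dvd F γ ?_)⟩
  rw [map_sub, hts, aeval_C, ← IsScalarTower.algebraMap_apply, sub_self]

theorem exists_polynomialIVT_extension {K : Type u} [Field K] [CharZero K] {f : K}
    (hf : ¬ IsSumSq f) :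
    ∃ (R : Type u) (_ : Field R) (_ : LinearOrder R) (_ : IsStrictOrderedRing R) (φ : K →+* R),
      PolynomialIVT R ∧ φ f < 0 := by
  let L := AlgebraicClosure K
  have hbot : algebraMap K L f ∉ sumSqOf (⊥ : IntermediateField K L) := by
    intro h
    obtain ⟨x, hx, hs⟩ := isSumSq_of_mem_sumSqOf h
    apply hf
    have h1 := isSumSq_map (IntermediateField.botEquiv K L) hs
    have h2 : x = algebraMap K _ f := Subtype.ext hx
    rw [h2] at h1
    simpa using h1
  obtain ⟨F, -, hF⟩ := zorn_le_nonempty₀ {F : IntermediateField K L | algebraMap K L f ∉ sumSqOf F}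
    (fun c hc hchain F hF => ⟨sSup c, fun hmem => by
      obtain ⟨F', hF', h⟩ := exists_mem_sumSqOf_of_mem_sSup hchain ⟨F, hF⟩ hmem
      exact hc hF' h, fun F' hF' => le_sSup hF'⟩) ⊥ hbot
  have hB := becomesSumSq_of_maximal hF
  have hnot : ¬ IsSumSq (algebraMap K F f) := fun h => hF.1 (mem_sumSqOf_of_isSumSq h)
  have : CharZero F := charZero_of_injective_algebraMap (algebraMap K F).injective
  obtain ⟨o, ho, hneg⟩ := hB.exists_order hnot
  exact ⟨F, inferInstance, o, ho, algebraMap K F, hB.polynomialIVT hneg, hneg⟩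

end MaximalField

section Hilbert17

/-- A real polynomial that is nonnegative everywhere is a sum of squares of rational functions. -/
theorem isSumSq_algebraMap_of_nonneg {n : ℕ} (f : MvPolynomial (Fin n) ℝ)
    (hf : ∀ a, 0 ≤ MvPolynomial.eval a f) :
    IsSumSq (algebraMap (MvPolynomial (Fin n) ℝ) (FractionRing (MvPolynomial (Fin n) ℝ)) f) := by
  by_contra hcon
  have : CharZero (FractionRing (MvPolynomial (Fin n) ℝ)) :=
    charZero_of_injective_algebraMap (IsFractionRing.injective (MvPolynomial (Fin n) ℝ) _)
  obtain ⟨R, _, _, _, φ, hR, hneg⟩ := exists_polynomialIVT_extension hcon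
  let ψ : MvPolynomial (Fin n) ℝ →+* R := φ.comp (algebraMap _ _)
  obtain ⟨a, ha⟩ := exists_real_point_sign_eq hR (ψ.comp MvPolynomial.C) n
    (fun i => ψ (MvPolynomial.X i)) {f}
  have h1 := ha f (Finset.mem_singleton_self f)
  have h2 : MvPolynomial.eval₂Hom (ψ.comp MvPolynomial.C) (fun i => ψ (MvPolynomial.X i)) = ψ := by
    ext <;> simp
  rw [h2, sign_neg (show ψ f < 0 from hneg), sign_eq_neg_one_iff] at h1
  exact absurd (hf a) (not_le.2 h1)

end Hilbert17

section Hermite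

theorem aeval_mul_of_isHomogeneous {τ R S : Type*} [CommSemiring R] [CommSemiring S] [Algebra R S]
    {φ : MvPolynomial τ R} {m : ℕ} (hφ : φ.IsHomogeneous m) (c : S) (x : τ → S) :
    MvPolynomial.aeval (fun i => c * x i) φ = c ^ m * MvPolynomial.aeval x φ := by
  rw [MvPolynomial.aeval_def, MvPolynomial.aeval_def, MvPolynomial.eval₂_eq,
    MvPolynomial.eval₂_eq, Finset.mul_sum]
  refine Finset.sum_congr rfl fun e he => ?_
  have h := hφ (MvPolynomial.mem_support_iff.1 he)
  change Finsupp.weight (fun _ => 1) e = m at h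
  rw [← Finsupp.degree_eq_weight_one, Finsupp.degree_apply] at h
  simp only [mul_pow, Finset.prod_mul_distrib, Finset.prod_pow_eq_pow_sum, h]
  ring

variable {n d : ℕ} {p : MvPolynomial (Fin n) ℝ}

theorem aeval_mul_eq_sum (hp : MvPolynomial.constantCoeff p = 1) (hdeg : p.totalDegree = d)
    (z : ℂ) (x : Fin n → ℂ) :
    MvPolynomial.aeval (fun i => z * x i) p = 1 + ∑ i : Fin d,
      z ^ (d - (i : ℕ)) *
        MvPolynomial.aeval x (MvPolynomial.homogeneousComponent (d - (i : ℕ)) p) := by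
  have h1 : ∀ k, MvPolynomial.aeval (fun i => z * x i) (MvPolynomial.homogeneousComponent k p) =
      z ^ k * MvPolynomial.aeval x (MvPolynomial.homogeneousComponent k p) := fun k =>
    aeval_mul_of_isHomogeneous (MvPolynomial.homogeneousComponent_isHomogeneous k p) z x
  conv_lhs => rw [← MvPolynomial.sum_homogeneousComponent p, hdeg]
  rw [map_sum, Finset.sum_range_succ', add_comm, ← Finset.sum_range_reflect, Finset.sum_range]
  congr 1
  · rw [MvPolynomial.homogeneousComponent_zero, ← MvPolynomial.constantCoeff_eq, hp]
    simp
  · refine Finset.sum_congr rfl fun i _ => ?_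
    have : d - 1 - (i : ℕ) + 1 = d - i := by have := i.2; omega
    rw [this, h1]

/-- The eigenvalues of the companion matrix of a real-zero polynomial at a real point are real. -/
theorem im_eq_zero_of_vecMul_companionM (hRZ : IsRealZero p) (hdeg : p.totalDegree = d)
    (a : Fin n → ℝ) {w : Fin d → ℂ} (hw : w ≠ 0) {μ : ℂ}
    (h : w ᵥ* (companionM d p).map (MvPolynomial.aeval (fun i => (a i : ℂ))) = μ • w) :
    μ.im = 0 := by
  set x : Fin n → ℂ := fun i => (a i : ℂ) with hx
  rcases Nat.eq_zero_or_pos d with rfl | hd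
  · exact absurd (Subsingleton.elim w 0) hw
  have hstep : ∀ (j : ℕ) (hj : j + 1 < d), w ⟨j + 1, hj⟩ = μ * w ⟨j, by omega⟩ := fun j hj => by
    have h1 := congrFun h ⟨j, by omega⟩
    rw [Pi.smul_apply, smul_eq_mul] at h1
    rw [← h1, vecMul, dotProduct, Finset.sum_eq_single ⟨j + 1, hj⟩]
    · have : j ≠ d - 1 := by omega
      simp [companionM, this]
    · intro i _ hi
      have h2 : j ≠ d - 1 := by omega
      have h3 : (i : ℕ) ≠ j + 1 := fun h => hi (Fin.ext h)
      simp [companionM, h2, h3]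
    · simp
  have hpow : ∀ (j : ℕ) (hj : j < d), w ⟨j, hj⟩ = μ ^ j * w ⟨0, hd⟩ := fun j => by
    induction j with
    | zero => simp
    | succ j ih =>
      intro hj
      rw [hstep j hj, ih (by omega)]
      ring
  have hw0 : w ⟨0, hd⟩ ≠ 0 := fun h0 => hw (funext fun j => by
    rw [show j = ⟨j, j.2⟩ from rfl, hpow j j.2, h0]; simp)
  have hlast := congrFun h ⟨d - 1, by omega⟩
  rw [Pi.smul_apply, smul_eq_mul, hpow, vecMul, dotProduct] at hlast
  simp only [companionM, map_apply, if_true, map_neg] at hlast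
  have hsum : μ ^ d + ∑ i : Fin d, μ ^ (i : ℕ) *
      MvPolynomial.aeval x (MvPolynomial.homogeneousComponent (d - (i : ℕ)) p) = 0 := by
    apply mul_right_cancel₀ hw0
    have hpd : μ ^ d = μ * μ ^ (d - 1) := by rw [← pow_succ', Nat.sub_add_cancel hd]
    rw [zero_mul, add_mul, hpd, mul_assoc, ← hlast, Finset.sum_mul, ← Finset.sum_add_distrib]
    refine Finset.sum_eq_zero fun i _ => ?_
    rw [show w i = _ from hpow i i.2]
    ring
  by_cases hμ : μ = 0
  · simp [hμ]
  have h0 := hRZ.2 a μ⁻¹ (by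
    change MvPolynomial.aeval (fun i => μ⁻¹ * x i) p = 0
    rw [aeval_mul_eq_sum hRZ.1 hdeg]
    apply mul_left_cancel₀ (pow_ne_zero d hμ)
    rw [mul_zero, ← hsum, mul_add, mul_one, Finset.mul_sum]
    congr 1
    refine Finset.sum_congr rfl fun i _ => ?_
    rw [← mul_assoc]
    congr 1
    rw [inv_pow, ← pow_sub₀ _ hμ (Nat.sub_le _ _)]
    congr 1
    have := i.2
    omega)
  rw [Complex.inv_im, div_eq_zero_iff] at h0
  rcases h0 with h0 | h0
  · simpa using h0
  · exact absurd (Complex.normSq_eq_zero.1 h0) hμ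

theorem trace_sq_re_nonneg {d : ℕ} (M : Matrix (Fin d) (Fin d) ℂ)
    (hM : ∀ μ ∈ spectrum ℂ M, μ.im = 0) (v : ℝ[X]) :
    0 ≤ (trace (aeval M ((v.map (algebraMap ℝ ℂ)) ^ 2))).re := by
  set V := v.map (algebraMap ℝ ℂ)
  rw [trace_eq_sum_roots_charpoly]
  change 0 ≤ Complex.reAddGroupHom _
  rw [map_multiset_sum]
  apply Multiset.sum_nonneg
  intro r hr
  obtain ⟨μ, hμ, rfl⟩ := Multiset.mem_map.1 hr
  rcases Nat.eq_zero_or_pos d with rfl | hd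
  · simp [Matrix.charpoly] at hμ
  have : Nonempty (Fin d) := ⟨⟨0, hd⟩⟩
  have hsp : μ ∈ spectrum ℂ (aeval M (V ^ 2)) :=
    Matrix.mem_spectrum_iff_isRoot_charpoly.2 (isRoot_of_mem_roots hμ)
  rw [spectrum.map_polynomial_aeval_of_nonempty _ _
    (spectrum.nonempty_of_isAlgClosed_of_finiteDimensional ℂ M)] at hsp
  obtain ⟨k, hk, rfl⟩ := hsp
  have hk' : k = ((k.re : ℝ) : ℂ) := Complex.ext rfl (by simp [hM k hk])
  rw [hk']
  have : eval ((k.re : ℝ) : ℂ) V = ((v.eval k.re : ℝ) : ℂ) := by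
    simp only [V, eval_map_algebraMap]
    exact (aeval_algebraMap_apply_eq_algebraMap_eval k.re v)
  simp only [eval_pow, this]
  rw [← Complex.ofReal_pow]
  exact sq_nonneg (v.eval k.re)

theorem sum_mul_trace_eq {R : Type*} [CommRing R] {m d : ℕ} (M : Matrix (Fin d) (Fin d) R)
    (v : Fin m → R) :
    trace (aeval M ((∑ i, C (v i) * X ^ (i : ℕ)) ^ 2)) =
      ∑ i : Fin m, ∑ j : Fin m, v i * trace (M ^ ((i : ℕ) + (j : ℕ))) * v j := by
  simp only [sq, Finset.sum_mul_sum, map_sum, trace_sum, map_mul, aeval_C, aeval_X_pow]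
  refine Finset.sum_congr rfl fun i _ => Finset.sum_congr rfl fun j _ => ?_
  simp only [Algebra.algebraMap_eq_smul_one, smul_mul_assoc, one_mul, mul_smul_comm, ← pow_add, trace_smul, smul_eq_mul]
  ring

theorem eval_hermite_form_nonneg (hRZ : IsRealZero p) (hdeg : p.totalDegree = d)
    (w : Fin d → MvPolynomial (Fin n) ℝ) (a : Fin n → ℝ) :
    0 ≤ MvPolynomial.eval a (w ⬝ᵥ (hermiteM d p *ᵥ w)) := by
  set N := (companionM d p).map (MvPolynomial.eval a) with hN
  set M := (companionM d p).map (MvPolynomial.aeval (fun i => (a i : ℂ))) with hMdef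
  have hMN : M = N.map (algebraMap ℝ ℂ) := by
    ext i j
    simp only [hMdef, hN, map_apply]
    exact MvPolynomial.aeval_algebraMap_apply ℂ a _
  have hM : ∀ μ ∈ spectrum ℂ M, μ.im = 0 := by
    intro μ hμ
    rw [spectrum.mem_iff, Matrix.isUnit_iff_isUnit_det, isUnit_iff_ne_zero, not_not,
      ← Matrix.exists_vecMul_eq_zero_iff] at hμ
    obtain ⟨u, hu, h⟩ := hμ
    refine im_eq_zero_of_vecMul_companionM hRZ hdeg a hu ?_
    rw [Matrix.vecMul_sub, sub_eq_zero] at h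
    rw [← hMdef, ← h, Algebra.algebraMap_eq_smul_one, Matrix.vecMul_smul, Matrix.vecMul_one]
  have key := trace_sq_re_nonneg M hM (∑ i : Fin d, C (MvPolynomial.eval a (w i)) * X ^ (i : ℕ))
  have h1 : (∑ i : Fin d, C (MvPolynomial.eval a (w i)) * X ^ (i : ℕ) : ℝ[X]).map (algebraMap ℝ ℂ)
      = ∑ i : Fin d, C ((algebraMap ℝ ℂ) (MvPolynomial.eval a (w i))) * X ^ (i : ℕ) := by
    simp [Polynomial.map_sum]
  have h2 : ∀ k, trace (M ^ k) = algebraMap ℝ ℂ (MvPolynomial.eval a (trace (companionM d p ^ k))) := by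
    intro k
    rw [hMN, ← Matrix.map_pow, hN, ← Matrix.map_pow]
    simp [Matrix.trace]
  rw [h1, sum_mul_trace_eq] at key
  simp only [h2, ← map_mul, ← map_sum] at key
  convert key using 1
  simp only [dotProduct, mulVec, hermiteM, Finset.mul_sum, mul_assoc]
  simp

end Hermite

section GramMatrices

/-- The Gram matrices over `R`: sums of rank one matrices `v vᵀ`. -/
def gramMatrices (R : Type*) [CommRing R] (ι : Type*) : AddSubmonoid (Matrix ι ι R) :=
  AddSubmonoid.closure {M | ∃ v : ι → R, M = vecMulVec v v}

theorem vecMulVec_smul_self {R ι : Type*} [CommRing R] (c : R) (v : ι → R) :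
    vecMulVec (c • v) (c • v) = c ^ 2 • vecMulVec v v := by
  ext i j
  simp only [vecMulVec_apply, Pi.smul_apply, smul_eq_mul, Matrix.smul_apply]
  ring

theorem sq_smul_mem_gramMatrices {R ι : Type*} [CommRing R] (c : R) {M : Matrix ι ι R}
    (hM : M ∈ gramMatrices R ι) : c ^ 2 • M ∈ gramMatrices R ι := by
  induction hM using AddSubmonoid.closure_induction with
  | mem M hM =>
    obtain ⟨v, rfl⟩ := hM
    exact AddSubmonoid.subset_closure ⟨c • v, (vecMulVec_smul_self c v).symm⟩
  | zero => simp
  | add M N _ _ hM hN => simpa using add_mem hM hN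

theorem smul_vecMulVec_mem_gramMatrices {R ι : Type*} [CommRing R] {c : R} (hc : IsSumSq c)
    (v : ι → R) : c • vecMulVec v v ∈ gramMatrices R ι := by
  induction hc with
  | zero => simp
  | sq_add a _ ih =>
    rw [add_smul]
    refine add_mem (AddSubmonoid.subset_closure ⟨a • v, ?_⟩) ih
    rw [vecMulVec_smul_self, sq]

theorem exists_transpose_mul_eq_of_mem_gramMatrices {R : Type*} [CommRing R] {d : ℕ}
    {M : Matrix (Fin d) (Fin d) R} (hM : M ∈ gramMatrices R (Fin d)) :
    ∃ (k : ℕ) (_ : 0 < k) (Q : Matrix (Fin k) (Fin d) R), M = Qᵀ * Q := by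
  suffices ∃ (k : ℕ) (Q : Fin k → Fin d → R), M = ∑ i, vecMulVec (Q i) (Q i) by
    obtain ⟨k, Q, rfl⟩ := this
    refine ⟨k + 1, k.succ_pos, of (Fin.cons 0 Q), ?_⟩
    ext i j
    simp [mul_apply, Matrix.sum_apply, vecMulVec_apply, Fin.sum_univ_succ]
  induction hM using AddSubmonoid.closure_induction with
  | mem M hM =>
    obtain ⟨v, rfl⟩ := hM
    exact ⟨1, fun _ => v, by simp⟩
  | zero => exact ⟨0, Fin.elim0, by simp⟩
  | add M N _ _ hM hN =>
    obtain ⟨k, Q, rfl⟩ := hM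
    obtain ⟨l, P, rfl⟩ := hN
    exact ⟨k + l, Fin.append Q P, by simp [Fin.sum_univ_add]⟩

theorem mem_gramMatrices_of_isSumSq {K : Type*} [Field K] [CharZero K] {d : ℕ}
    {H : Matrix (Fin d) (Fin d) K} (hsymm : H.IsSymm) (hH : ∀ w, IsSumSq (w ⬝ᵥ (H *ᵥ w))) :
    H ∈ gramMatrices K (Fin d) := by
  let : Invertible (2 : K) := invertibleOfNonzero two_ne_zero
  have hB : LinearMap.IsSymm (Matrix.toBilin' H) :=
    LinearMap.isSymm_def.2 (isSymm_toBilin'_iff_isSymm.2 hsymm).eq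
  obtain ⟨b, hb⟩ := LinearMap.BilinForm.exists_orthogonal_basis hB
  rw [LinearMap.isOrthoᵢ_def] at hb
  have key : H = ∑ k, (b k ⬝ᵥ (H *ᵥ b k)) •
      vecMulVec (fun i => b.repr (Pi.single i 1) k) (fun i => b.repr (Pi.single i 1) k) := by
    ext i j
    conv_lhs => rw [← Matrix.toBilin'_single H i j,
      ← LinearMap.BilinForm.sum_repr_mul_repr_mul b]
    rw [Finsupp.sum_fintype _ _ (by simp), Matrix.sum_apply]
    refine Finset.sum_congr rfl fun k _ => ?_
    rw [Finsupp.sum_fintype _ _ (by simp), Finset.sum_eq_single k]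
    · rw [Matrix.toBilin'_apply']
      simp only [smul_eq_mul, Matrix.smul_apply, vecMulVec_apply]
      ring
    · intro l _ hl
      rw [hb k l hl.symm]
      simp
    · simp
  rw [key]
  exact sum_mem fun k _ => smul_vecMulVec_mem_gramMatrices (hH _) _

variable {A K : Type*} [CommRing A] [IsDomain A] [Field K] [Algebra A K] [IsFractionRing A K]

theorem exists_common_denominator {d : ℕ} (w : Fin d → K) :
    ∃ (c : A) (v : Fin d → A), c ≠ 0 ∧ algebraMap A K c • w = algebraMap A K ∘ v := by
  obtain ⟨c, hc⟩ := IsLocalization.exist_integer_multiples_of_finite (nonZeroDivisors A) w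
  choose v hv using hc
  exact ⟨c, v, nonZeroDivisors.ne_zero c.2, funext fun i => by
    simpa [Algebra.smul_def, Submonoid.smul_def] using (hv i).symm⟩

theorem exists_sq_smul_eq_map_of_mem_gramMatrices {d : ℕ} {M : Matrix (Fin d) (Fin d) K}
    (hM : M ∈ gramMatrices K (Fin d)) :
    ∃ (c : A) (N : Matrix (Fin d) (Fin d) A), c ≠ 0 ∧ N ∈ gramMatrices A (Fin d) ∧
      algebraMap A K c ^ 2 • M = N.map (algebraMap A K) := by
  induction hM using AddSubmonoid.closure_induction with
  | mem M hM =>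
    obtain ⟨w, rfl⟩ := hM
    obtain ⟨c, v, hc, h⟩ := exists_common_denominator (A := A) w
    refine ⟨c, vecMulVec v v, hc, AddSubmonoid.subset_closure ⟨v, rfl⟩, ?_⟩
    rw [← vecMulVec_smul_self, h]
    ext i j
    simp [vecMulVec_apply]
  | zero => exact ⟨1, 0, one_ne_zero, zero_mem _, by simp⟩
  | add M M' _ _ hM hM' =>
    obtain ⟨c, N, hc, hN, h⟩ := hM
    obtain ⟨c', N', hc', hN', h'⟩ := hM'
    refine ⟨c * c', c' ^ 2 • N + c ^ 2 • N', mul_ne_zero hc hc',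
      add_mem (sq_smul_mem_gramMatrices _ hN) (sq_smul_mem_gramMatrices _ hN'), ?_⟩
    ext i j
    have h1 := congrFun (congrFun h i) j
    have h2 := congrFun (congrFun h' i) j
    simp only [Matrix.smul_apply, Matrix.add_apply, map_apply, smul_eq_mul, map_mul, map_add, map_pow] at h1 h2 ⊢
    rw [← h1, ← h2]
    ring

theorem exists_sq_smul_mem_gramMatrices [CharZero K] {d : ℕ} {H : Matrix (Fin d) (Fin d) A}
    (hsymm : H.IsSymm) (hH : ∀ w : Fin d → A, IsSumSq (algebraMap A K (w ⬝ᵥ (H *ᵥ w)))) :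
    ∃ c : A, c ≠ 0 ∧ c ^ 2 • H ∈ gramMatrices A (Fin d) := by
  have hmem : H.map (algebraMap A K) ∈ gramMatrices K (Fin d) := by
    refine mem_gramMatrices_of_isSumSq (hsymm.map _) fun w => ?_
    obtain ⟨c, v, hc, h⟩ := exists_common_denominator (A := A) w
    have hc' : algebraMap A K c ≠ 0 := by simpa using hc
    have hw : w = (algebraMap A K c)⁻¹ • (algebraMap A K ∘ v) := by
      rw [← h, smul_smul, inv_mul_cancel₀ hc', one_smul]
    have h2 : algebraMap A K (v ⬝ᵥ (H *ᵥ v)) =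
        (algebraMap A K ∘ v) ⬝ᵥ (H.map (algebraMap A K) *ᵥ (algebraMap A K ∘ v)) := by
      simp [dotProduct, mulVec]
    rw [hw, mulVec_smul, dotProduct_smul, smul_dotProduct, ← h2, smul_smul, smul_eq_mul]
    exact (IsSumSq.mul_self _).mul (hH v)
  obtain ⟨c, N, hc, hN, h⟩ := exists_sq_smul_eq_map_of_mem_gramMatrices (A := A) hmem
  refine ⟨c, hc, ?_⟩
  convert hN
  ext i j
  have h1 := congrFun (congrFun h i) j
  apply IsFractionRing.injective A K
  simpa using h1

end GramMatrices

section Homogenize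

variable {n d : ℕ}

/-- The substitution `x ↦ s x`, as a polynomial in the new variable `s`. The coefficients are the
homogeneous components. -/
noncomputable def scaleVars (n : ℕ) :
    MvPolynomial (Fin n) ℝ →ₐ[ℝ] (MvPolynomial (Fin n) ℝ)[X] :=
  MvPolynomial.aeval fun i => X * C (MvPolynomial.X i)

theorem aeval_C_X (f : MvPolynomial (Fin n) ℝ) :
    MvPolynomial.aeval (fun i => (C (MvPolynomial.X i) : (MvPolynomial (Fin n) ℝ)[X])) f = C f := by
  have := MvPolynomial.aeval_algebraMap_apply (MvPolynomial (Fin n) ℝ)[X]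
    (fun i => (MvPolynomial.X i : MvPolynomial (Fin n) ℝ)) f
  rwa [show MvPolynomial.aeval (fun i => MvPolynomial.X i) f = f from MvPolynomial.aeval_X_left_apply f] at this

theorem scaleVars_of_isHomogeneous {f : MvPolynomial (Fin n) ℝ} {m : ℕ} (hf : f.IsHomogeneous m) :
    scaleVars n f = X ^ m * C f := by
  rw [scaleVars, aeval_mul_of_isHomogeneous hf, aeval_C_X]

theorem isHomogeneous_coeff_scaleVars (f : MvPolynomial (Fin n) ℝ) (e : ℕ) :
    ((scaleVars n f).coeff e).IsHomogeneous e := by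
  rw [← MvPolynomial.sum_homogeneousComponent f, map_sum, finsetSum_coeff]
  refine MvPolynomial.IsHomogeneous.sum _ _ _ fun k _ => ?_
  have hk := MvPolynomial.homogeneousComponent_isHomogeneous k f
  rw [scaleVars_of_isHomogeneous hk, mul_comm, coeff_C_mul_X_pow]
  split_ifs with h
  · rwa [h]
  · exact MvPolynomial.isHomogeneous_zero _ _ _

theorem eval_one_scaleVars (f : MvPolynomial (Fin n) ℝ) : (scaleVars n f).eval 1 = f := by
  have : ((aeval (1 : MvPolynomial (Fin n) ℝ)).restrictScalars ℝ).comp (scaleVars n) =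
      AlgHom.id ℝ _ := by
    ext i
    simp [scaleVars]
  simpa [aeval_def, eval₂_eq_eval_map] using DFunLike.congr_fun this f

theorem scaleVars_companionM_pow (p : MvPolynomial (Fin n) ℝ) (k : ℕ) :
    diagonal (fun i : Fin d => (X : (MvPolynomial (Fin n) ℝ)[X]) ^ (i : ℕ)) *
        (companionM d p ^ k).map (scaleVars n) =
      (X : (MvPolynomial (Fin n) ℝ)[X]) ^ k • ((companionM d p ^ k).map C *
        diagonal fun i : Fin d => (X : (MvPolynomial (Fin n) ℝ)[X]) ^ (i : ℕ)) := by
  set D := diagonal (fun i : Fin d => (X : (MvPolynomial (Fin n) ℝ)[X]) ^ (i : ℕ))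
  have h1 : D * (companionM d p).map (scaleVars n) =
      (X : (MvPolynomial (Fin n) ℝ)[X]) • ((companionM d p).map C * D) := by
    ext1 i j
    rw [diagonal_mul, Matrix.smul_apply, mul_diagonal]
    simp only [map_apply, companionM, smul_eq_mul]
    have hi := i.2
    split_ifs with h h'
    · rw [map_neg, scaleVars_of_isHomogeneous (MvPolynomial.homogeneousComponent_isHomogeneous _ p),
        h, map_neg]
      have e1 : (X : (MvPolynomial (Fin n) ℝ)[X]) ^ (i : ℕ) * X ^ (d - (i : ℕ)) = X * X ^ (d - 1) := by
        rw [← pow_add, ← pow_succ']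
        congr 1
        omega
      linear_combination (-C (MvPolynomial.homogeneousComponent (d - (i : ℕ)) p)) * e1
    · rw [h', map_one, map_one]
      ring
    · simp
  induction k with
  | zero => simp
  | succ k ih =>
    have h2 : (companionM d p ^ (k + 1)).map (scaleVars n) =
        (companionM d p ^ k).map (scaleVars n) * (companionM d p).map (scaleVars n) := by
      rw [pow_succ]
      exact Matrix.map_mul (f := (scaleVars n).toRingHom)
    have h3 : (companionM d p ^ (k + 1)).map (C : MvPolynomial (Fin n) ℝ →+* _) =
        (companionM d p ^ k).map C * (companionM d p).map C := by
      rw [pow_succ, Matrix.map_mul]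
    rw [h2, ← mul_assoc, ih, smul_mul_assoc, mul_assoc, h1, mul_smul_comm, smul_smul, h3,
      mul_assoc, pow_succ]

theorem scaleVars_hermiteM (p : MvPolynomial (Fin n) ℝ) (i j : Fin d) :
    scaleVars n (hermiteM d p i j) = X ^ ((i : ℕ) + (j : ℕ)) * C (hermiteM d p i j) := by
  simp only [hermiteM, trace, diag_apply, map_sum, Finset.mul_sum]
  refine Finset.sum_congr rfl fun l _ => ?_
  have h := congrFun (congrFun (scaleVars_companionM_pow (d := d) p ((i : ℕ) + (j : ℕ))) l) l
  rw [diagonal_mul, Matrix.smul_apply, mul_diagonal, map_apply, map_apply, smul_eq_mul] at h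
  apply mul_left_cancel₀ (pow_ne_zero (l : ℕ) (X_ne_zero (R := MvPolynomial (Fin n) ℝ)))
  rw [h]
  ring

theorem eq_zero_of_sum_sq_eq_zero {ι : Type*} {s : Finset ι} {f : ι → MvPolynomial (Fin n) ℝ}
    (h : ∑ k ∈ s, f k ^ 2 = 0) : ∀ k ∈ s, f k = 0 := by
  intro k hk
  refine MvPolynomial.funext fun a => ?_
  have h1 := congrArg (MvPolynomial.eval a) h
  simp only [map_sum, map_pow, map_zero] at h1
  rw [Finset.sum_eq_zero_iff_of_nonneg fun i _ => sq_nonneg _] at h1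
  simpa using h1 k hk

theorem X_pow_dvd_of_dvd_sum_sq {ι : Type*} {s : Finset ι} (m : ℕ) :
    ∀ {g : ι → (MvPolynomial (Fin n) ℝ)[X]}, X ^ (2 * m) ∣ ∑ k ∈ s, g k ^ 2 →
      ∀ k ∈ s, X ^ m ∣ g k := by
  induction m with
  | zero => simp
  | succ m ih =>
    intro g hg
    have hX : ∀ k ∈ s, X ∣ g k := by
      have h1 : X ∣ ∑ k ∈ s, g k ^ 2 := (dvd_pow_self X (by omega)).trans hg
      rw [X_dvd_iff, coeff_zero_eq_eval_zero, eval_finsetSum] at h1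
      simp only [eval_pow] at h1
      intro k hk
      rw [X_dvd_iff, coeff_zero_eq_eval_zero]
      exact eq_zero_of_sum_sq_eq_zero h1 k hk
    choose! h hh using hX
    have h2 : ∑ k ∈ s, g k ^ 2 = X ^ 2 * ∑ k ∈ s, h k ^ 2 := by
      rw [Finset.mul_sum]
      refine Finset.sum_congr rfl fun k hk => ?_
      rw [hh k hk]
      ring
    rw [h2, show 2 * (m + 1) = 2 + 2 * m by ring, pow_add,
      mul_dvd_mul_iff_left (pow_ne_zero 2 X_ne_zero)] at hg
    intro k hk
    rw [hh k hk, pow_succ']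
    exact mul_dvd_mul_left X (ih hg k hk)

theorem exists_isHomogeneous_sq_smul_hermiteM {p q : MvPolynomial (Fin n) ℝ} (hq : q ≠ 0) {k : ℕ}
    {Q : Matrix (Fin k) (Fin d) (MvPolynomial (Fin n) ℝ)} (hQ : q ^ 2 • hermiteM d p = Qᵀ * Q) :
    ∃ (q' : MvPolynomial (Fin n) ℝ) (r : ℕ), q' ≠ 0 ∧ q'.IsHomogeneous r ∧
      ∃ Q' : Matrix (Fin k) (Fin d) (MvPolynomial (Fin n) ℝ),
        q' ^ 2 • hermiteM d p = Q'ᵀ * Q' := by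
  have hσ : scaleVars n q ≠ 0 := fun h => hq (by rw [← eval_one_scaleVars q, h, eval_zero])
  obtain ⟨g, hg, hndvd⟩ := exists_eq_pow_rootMultiplicity_mul_and_not_dvd _ hσ 0
  set r := rootMultiplicity 0 (scaleVars n q)
  rw [C_0, sub_zero] at hg hndvd
  have hentry : ∀ i j : Fin d, (X ^ r * g) ^ 2 * (X ^ ((i : ℕ) + (j : ℕ)) * C (hermiteM d p i j)) =
      ∑ l, scaleVars n (Q l i) * scaleVars n (Q l j) := fun i j => by
    have h := congrArg (scaleVars n) (congrFun (congrFun hQ i) j)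
    rw [Matrix.smul_apply, smul_eq_mul, map_mul, map_pow, scaleVars_hermiteM, hg, mul_apply,
      map_sum] at h
    simpa only [map_mul, transpose_apply] using h
  have hdvd : ∀ (i : Fin d) (l : Fin k), X ^ (r + (i : ℕ)) ∣ scaleVars n (Q l i) := fun i l => by
    refine X_pow_dvd_of_dvd_sum_sq (s := Finset.univ) (g := fun l => scaleVars n (Q l i)) _ ?_ l
      (Finset.mem_univ l)
    simp only [sq (scaleVars n _)]
    rw [← hentry i i]
    exact ⟨g ^ 2 * C (hermiteM d p i i), by ring⟩
  choose P hP using hdvd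
  refine ⟨g.eval 0, r, ?_, ?_, of fun l i => (P i l).eval 0, ?_⟩
  · rwa [← coeff_zero_eq_eval_zero, Ne, ← X_dvd_iff]
  · have := isHomogeneous_coeff_scaleVars q r
    rwa [hg, coeff_X_pow_mul', if_pos le_rfl, Nat.sub_self, coeff_zero_eq_eval_zero] at this
  · ext1 i j
    have h : g ^ 2 * C (hermiteM d p i j) = ∑ l, P i l * P j l := by
      apply mul_left_cancel₀ (pow_ne_zero (2 * r + (i : ℕ) + (j : ℕ))
        (X_ne_zero (R := MvPolynomial (Fin n) ℝ)))
      have h1 := hentry i j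
      simp only [hP] at h1
      rw [Finset.mul_sum]
      calc _ = (X ^ r * g) ^ 2 * (X ^ ((i : ℕ) + (j : ℕ)) * C (hermiteM d p i j)) := by ring
        _ = _ := h1
        _ = _ := Finset.sum_congr rfl fun l _ => by ring
    have h0 := congrArg (eval 0) h
    rw [eval_finsetSum] at h0
    simpa [mul_apply] using h0

end Homogenize

end

/-- Let `p` be a real-zero polynomial of degree `d`. Then there exist a nonzero homogeneous
polynomial `q`, an integer `k > 0` and a `k × d` polynomial matrix `𝓠` such that
`q² · 𝓗(p) = 𝓠ᵀ𝓠`. -/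
theorem hermite_sos_with_denominator {n : ℕ} (p : MvPolynomial (Fin n) ℝ) (d : ℕ)
    (hRZ : IsRealZero p) (hdeg : p.totalDegree = d) :
    ∃ (q : MvPolynomial (Fin n) ℝ) (r : ℕ), q ≠ 0 ∧ q.IsHomogeneous r ∧
      ∃ (k : ℕ) (_ : 0 < k) (Q : Matrix (Fin k) (Fin d) (MvPolynomial (Fin n) ℝ)),
        q ^ 2 • hermiteM d p = Qᵀ * Q := by
  have : CharZero (FractionRing (MvPolynomial (Fin n) ℝ)) :=
    charZero_of_injective_algebraMap (IsFractionRing.injective (MvPolynomial (Fin n) ℝ) _)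
  have hsymm : (hermiteM d p).IsSymm := by
    ext i j
    simp [hermiteM, add_comm]
  obtain ⟨q, hq, hmem⟩ := exists_sq_smul_mem_gramMatrices
    (K := FractionRing (MvPolynomial (Fin n) ℝ)) hsymm
    fun w => isSumSq_algebraMap_of_nonneg _ (eval_hermite_form_nonneg hRZ hdeg w)
  obtain ⟨k, hk, Q, hQ⟩ := exists_transpose_mul_eq_of_mem_gramMatrices hmem
  obtain ⟨q', r, hq', hhom, Q', hQ'⟩ := exists_isHomogeneous_sq_smul_hermiteM hq hQ
  exact ⟨q', r, hq', hhom, k, hk, Q', hQ'⟩
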